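/- arXiv:2506.23882 — 4 statements merged into one kernel-verified Lean document; each statement's English description precedes it below -/
import Mathlib

section
/- There exists an absolute constant c₁ with 0 < c₁ ≤ 1 such that for every real constant c with 0 < c < 1/2 there exist a constant C > 0 and a threshold x₀ with the following property: for every real x ≥ x₀ and every integer k with 1 ≤ k ≤ (log log x)/(log log log log x), the number of positive integers n ≤ x satisfying φ_{k+1}(n) ≥ c·n is at most (6/((k-1)!·e^{(k-1)γ}·π²)) · x/(c·(log log log x)^{k+1}) + C · x·exp((log log log x)²) / ((log x)^{c₁}·(log log log x)²). -/
open Real Finset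

open scoped Classical in
/-- For a divisor-closed set of positive integers, the counting function is controlled by the
sum of reciprocals. -/
lemma card_mul_log_le_of_dvd_closed (A : Set ℕ) (hA : ∀ m n, m ∣ n → n ∈ A → m ∈ A)
    {x : ℝ} (hx : 1 ≤ x) :
    (((Finset.Icc 1 ⌊x⌋₊).filter (· ∈ A)).card : ℝ) * Real.log x ≤
      (Real.log 4 + 5) * x * ∑ n ∈ (Finset.Icc 1 ⌊x⌋₊).filter (· ∈ A), (n : ℝ)⁻¹ := by
  set T := (Finset.Icc 1 ⌊x⌋₊).filter (· ∈ A) with hT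
  have hx0 : 0 ≤ x := by linarith
  let f : ArithmeticFunction ℝ := ⟨fun n ↦ if n ≠ 0 ∧ n ∈ A then 1 else 0, by simp⟩
  have hf (n : ℕ) : f n = if n ≠ 0 ∧ n ∈ A then 1 else 0 := rfl
  have hpos (n : ℕ) (hn : n ∈ T) : (1 : ℝ) ≤ n ∧ (n : ℝ) ≤ x := by
    simp only [hT, mem_filter, mem_Icc] at hn
    exact ⟨by exact_mod_cast hn.1.1, (Nat.le_floor_iff hx0).1 hn.1.2⟩
  have hlog : ∑ n ∈ T, Real.log n ≤ ∑ n ∈ Ioc 0 ⌊x⌋₊, (f * ArithmeticFunction.vonMangoldt) n := by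
    have hnn (n : ℕ) : 0 ≤ (f * ArithmeticFunction.vonMangoldt) n := by
      rw [ArithmeticFunction.mul_apply]
      refine sum_nonneg fun p _ ↦ mul_nonneg ?_ ArithmeticFunction.vonMangoldt_nonneg
      rw [hf]; split_ifs <;> norm_num
    refine le_trans (sum_le_sum fun n hn ↦ ?_)
      (sum_le_sum_of_subset_of_nonneg (s := T) ?_ fun n _ _ ↦ hnn n)
    · simp only [hT, mem_filter, mem_Icc] at hn
      rw [ArithmeticFunction.mul_apply, ← ArithmeticFunction.vonMangoldt_sum,
        ← Nat.sum_divisorsAntidiagonal' (f := fun _ b ↦ ArithmeticFunction.vonMangoldt b)]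
      refine sum_le_sum fun p hp ↦ ?_
      have hp' := Nat.mem_divisorsAntidiagonal.1 hp
      have h1 : p.1 ∣ n := ⟨p.2, hp'.1.symm⟩
      rw [hf, if_pos ⟨ne_zero_of_dvd_ne_zero hp'.2 h1, hA _ _ h1 hn.2⟩, one_mul]
    · intro n hn
      simp only [hT, mem_filter, mem_Icc] at hn
      simp only [mem_Ioc]; omega
  have hpsi : ∑ n ∈ Ioc 0 ⌊x⌋₊, (f * ArithmeticFunction.vonMangoldt) n ≤
      ∑ n ∈ T, (Real.log 4 + 4) * x * (n : ℝ)⁻¹ := by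
    rw [ArithmeticFunction.sum_Ioc_mul_eq_sum_sum, hT, sum_filter]
    have hI : Ioc 0 ⌊x⌋₊ = Icc 1 ⌊x⌋₊ := by ext; simp; omega
    rw [hI]
    refine sum_le_sum fun n hn ↦ ?_
    have hn1 := (mem_Icc.1 hn).1
    rw [hf]
    split_ifs with h1 h2
    · have : ∑ m ∈ Ioc 0 (⌊x⌋₊ / n), ArithmeticFunction.vonMangoldt m =
          Chebyshev.psi (x / n) := by
        rw [Chebyshev.psi, Nat.floor_div_natCast]
      rw [this, one_mul]
      refine (Chebyshev.psi_le_const_mul_self (by positivity)).trans (le_of_eq ?_)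
      rw [div_eq_mul_inv, mul_assoc]
    · exact absurd h1.2 h2
    · exact absurd ⟨by omega, ‹n ∈ A›⟩ h1
    · simp
  have hdiff : ∑ n ∈ T, (Real.log x - Real.log n) ≤ ∑ n ∈ T, x * (n : ℝ)⁻¹ := by
    refine sum_le_sum fun n hn ↦ ?_
    obtain ⟨h1, h2⟩ := hpos n hn
    rw [← Real.log_div (by linarith) (by linarith), ← div_eq_mul_inv]
    exact Real.log_le_self (by positivity)
  rw [sum_sub_distrib, sum_const, nsmul_eq_mul] at hdiff
  rw [← mul_sum] at hdiff hpsi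
  linarith

open scoped Classical in
/-- The completely multiplicative function `n ↦ n ^ (-s)` restricted to integers without prime
factors in `Q`. -/
noncomputable def avoidingRpowHom (Q : Set ℕ) (s : ℝ) (hs : s ≠ 0) : ℕ →*₀ ℝ where
  toFun n := if ∀ p, p.Prime → p ∣ n → p ∉ Q then ((n : ℝ) ^ s)⁻¹ else 0
  map_zero' := by simp [Real.zero_rpow hs]
  map_one' := by
    rw [if_pos]
    · simp
    · intro p hp h1
      exact absurd (Nat.dvd_one.1 h1) hp.ne_one
  map_mul' m n := by
    have : (∀ p, p.Prime → p ∣ m * n → p ∉ Q) ↔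
        (∀ p, p.Prime → p ∣ m → p ∉ Q) ∧ (∀ p, p.Prime → p ∣ n → p ∉ Q) :=
      ⟨fun h ↦ ⟨fun p hp hd ↦ h p hp (hd.mul_right _), fun p hp hd ↦ h p hp (hd.mul_left _)⟩,
        fun h p hp hd ↦ (hp.dvd_mul.1 hd).elim (h.1 p hp) (h.2 p hp)⟩
    simp only [this]
    by_cases h1 : ∀ p, p.Prime → p ∣ m → p ∉ Q <;>
    by_cases h2 : ∀ p, p.Prime → p ∣ n → p ∉ Q
    · rw [if_pos ⟨h1, h2⟩, if_pos h1, if_pos h2, Nat.cast_mul,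
        Real.mul_rpow (by positivity) (by positivity), mul_inv]
    · rw [if_neg (fun h ↦ h2 h.2), if_neg h2, mul_zero]
    · rw [if_neg (fun h ↦ h1 h.1), if_neg h1, zero_mul]
    · rw [if_neg (fun h ↦ h1 h.1), if_neg h1, zero_mul]

open scoped Classical in
lemma avoidingRpowHom_apply (Q : Set ℕ) (s : ℝ) (hs : s ≠ 0) (n : ℕ) :
    avoidingRpowHom Q s hs n =
      if ∀ p, p.Prime → p ∣ n → p ∉ Q then ((n : ℝ) ^ s)⁻¹ else 0 := rfl

lemma avoidingRpowHom_nonneg (Q : Set ℕ) (s : ℝ) (hs : s ≠ 0) (n : ℕ) :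
    0 ≤ avoidingRpowHom Q s hs n := by
  rw [avoidingRpowHom_apply]; split_ifs <;> positivity

lemma avoidingRpowHom_le (Q : Set ℕ) (s : ℝ) (hs : s ≠ 0) (n : ℕ) :
    avoidingRpowHom Q s hs n ≤ ((n : ℝ) ^ s)⁻¹ := by
  rw [avoidingRpowHom_apply]; split_ifs
  · rfl
  · positivity

lemma avoidingRpowHom_prime {Q : Set ℕ} {s : ℝ} (hs : s ≠ 0) {p : ℕ} (hp : p.Prime) :
    avoidingRpowHom Q s hs p = Q.indicator 0 p + Qᶜ.indicator (fun n : ℕ ↦ ((n : ℝ) ^ s)⁻¹) p := by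
  rw [avoidingRpowHom_apply]
  by_cases h : p ∈ Q
  · rw [if_neg]
    · simp [h]
    · exact fun H ↦ H p hp dvd_rfl h
  · rw [if_pos]
    · simp [h]
    · intro q hq hqp
      rwa [(Nat.prime_dvd_prime_iff_eq hq hp).1 hqp]

lemma summable_avoidingRpowHom (Q : Set ℕ) {s : ℝ} (hs : 1 < s) :
    Summable (avoidingRpowHom Q s (by linarith)) :=
  Summable.of_nonneg_of_le (avoidingRpowHom_nonneg Q s _) (avoidingRpowHom_le Q s _)
    (Real.summable_nat_rpow_inv.2 hs)

/-- Removing the primes in `Q` from the Euler product of `ζ` saves at least the exponential of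
the corresponding prime sum. -/
lemma tsum_avoidingRpowHom_mul_exp_le {Q : Set ℕ} (hQ : ∀ p ∈ Q, p.Prime) {s : ℝ} (hs : 1 < s) :
    (∑' n, avoidingRpowHom Q s (by linarith) n) *
      Real.exp (∑' n, Q.indicator (fun n : ℕ ↦ ((n : ℝ) ^ s)⁻¹) n) ≤
      ∑' n : ℕ, 1 / (n : ℝ) ^ s := by
  have hs0 : s ≠ 0 := by linarith
  have hnorm (R : Set ℕ) : Summable (‖avoidingRpowHom R s hs0 ·‖) := by
    simpa only [Real.norm_of_nonneg (avoidingRpowHom_nonneg R s hs0 _)] using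
      summable_avoidingRpowHom R hs
  have h1 := EulerProduct.eulerProduct_completely_multiplicative (hnorm Q)
  have h2 := EulerProduct.eulerProduct_completely_multiplicative (hnorm ∅)
  have hS : Summable (Q.indicator (fun n : ℕ ↦ ((n : ℝ) ^ s)⁻¹)) :=
    (Real.summable_nat_rpow_inv.2 hs).indicator Q
  have h3 := (Real.continuous_exp.tendsto _).comp hS.hasSum.tendsto_sum_nat
  have hz : ∑' n, avoidingRpowHom ∅ s hs0 n = ∑' n : ℕ, 1 / (n : ℝ) ^ s := by
    refine tsum_congr fun n ↦ ?_
    simp [avoidingRpowHom_apply]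
  rw [hz] at h2
  refine le_of_tendsto_of_tendsto' (h1.mul h3) h2 fun N ↦ ?_
  have hsum : ∑ i ∈ range N, Q.indicator (fun n : ℕ ↦ ((n : ℝ) ^ s)⁻¹) i =
      ∑ i ∈ N.primesBelow, Q.indicator (fun n : ℕ ↦ ((n : ℝ) ^ s)⁻¹) i := by
    symm
    refine sum_subset (filter_subset _ _) fun i hi hi' ↦ ?_
    refine Set.indicator_of_notMem (fun hq ↦ hi' ?_) _
    exact Nat.mem_primesBelow.2 ⟨mem_range.1 hi, hQ i hq⟩
  have hlt {p : ℕ} (hp : p.Prime) : ((p : ℝ) ^ s)⁻¹ < 1 :=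
    inv_lt_one_of_one_lt₀ (Real.one_lt_rpow (by exact_mod_cast hp.one_lt) (by linarith))
  simp only [Function.comp]
  rw [hsum, Real.exp_sum, ← prod_mul_distrib]
  refine prod_le_prod (fun p hp ↦ ?_) fun p hp ↦ ?_
  · have hp' := (Nat.mem_primesBelow.1 hp).2
    have := (avoidingRpowHom_le Q s hs0 p).trans_lt (hlt hp')
    have : 0 < 1 - avoidingRpowHom Q s hs0 p := by linarith
    positivity
  · have hp' := (Nat.mem_primesBelow.1 hp).2
    have hl := hlt hp'
    rw [avoidingRpowHom_prime hs0 hp', avoidingRpowHom_prime hs0 hp']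
    by_cases h : p ∈ Q
    · simp only [h, Set.indicator_of_mem, Set.mem_compl_iff, not_true_eq_false,
        not_false_eq_true, Set.indicator_of_notMem, Set.mem_empty_iff_false, Pi.zero_apply,
        zero_add, sub_zero, inv_one, one_mul]
      have := Real.one_sub_le_exp_neg ((p : ℝ) ^ s)⁻¹
      rw [← inv_inv (Real.exp _), ← Real.exp_neg]
      exact inv_anti₀ (by linarith) this
    · simp [h]

lemma summable_log_mul_rpow_inv {s : ℝ} (hs : 1 < s) :
    Summable fun n : ℕ ↦ Real.log n * ((n : ℝ) ^ s)⁻¹ := by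
  obtain ⟨ε, hε⟩ : ∃ ε, ε = (s - 1) / 2 := ⟨_, rfl⟩
  have hε0 : 0 < ε := by linarith
  have h : Summable fun n : ℕ ↦ ε⁻¹ * ((n : ℝ) ^ (s - ε))⁻¹ :=
    (Real.summable_nat_rpow_inv.2 (by linarith)).mul_left _
  refine Summable.of_nonneg_of_le (fun n ↦ by positivity) (fun n ↦ ?_) h
  rcases Nat.eq_zero_or_pos n with rfl | hn
  · simp only [Nat.cast_zero, Real.log_zero, zero_mul]; positivity
  · have hn' : (0 : ℝ) < n := by exact_mod_cast hn
    have h1 := Real.log_le_rpow_div hn'.le hε0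
    rw [Real.rpow_sub hn', inv_div]
    calc _ ≤ (n : ℝ) ^ ε / ε * ((n : ℝ) ^ s)⁻¹ := by gcongr
      _ = _ := by field_simp

/-- The Dirichlet-series form of the prime number theorem in progressions (lower bound), with
prime powers removed. -/
lemma primes_in_class_log_sum_lower {m : ℕ} [NeZero m] (a : (ZMod m)ˣ) :
    ∃ C : ℝ, ∀ s ∈ Set.Ioc (1 : ℝ) 2, (m.totient : ℝ)⁻¹ / (s - 1) - C ≤
      ∑' n : ℕ, {n : ℕ | n.Prime ∧ (n : ZMod m) = a}.indicator
        (fun n : ℕ ↦ Real.log n * ((n : ℝ) ^ s)⁻¹) n := by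
  obtain ⟨C, hC⟩ := ArithmeticFunction.vonMangoldt.LSeries_residueClass_lower_bound a.isUnit
  have hK := ArithmeticFunction.vonMangoldt.summable_residueClass_non_primes_div (a : ZMod m)
  set g : ℕ → ℝ := fun n ↦
    (if n.Prime then 0 else ArithmeticFunction.vonMangoldt.residueClass (a : ZMod m) n) / n
  refine ⟨C + ∑' n, g n, fun s hs ↦ ?_⟩
  have hS : Summable ({n : ℕ | n.Prime ∧ (n : ZMod m) = a}.indicator
      (fun n : ℕ ↦ Real.log n * ((n : ℝ) ^ s)⁻¹)) := (summable_log_mul_rpow_inv hs.1).indicator _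
  have key (n : ℕ) : ArithmeticFunction.vonMangoldt.residueClass (a : ZMod m) n / (n : ℝ) ^ s ≤
      {n : ℕ | n.Prime ∧ (n : ZMod m) = a}.indicator
        (fun n : ℕ ↦ Real.log n * ((n : ℝ) ^ s)⁻¹) n + g n := by
    rcases Nat.eq_zero_or_pos n with rfl | hn0
    · rw [Set.indicator_of_notMem (fun h ↦ Nat.not_prime_zero h.1)]
      simp [g]
    by_cases hp : n.Prime
    · by_cases ha : (n : ZMod m) = a
      · simp [hp, ha, g, Set.indicator, ArithmeticFunction.vonMangoldt_apply_prime hp,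
          div_eq_mul_inv]
      · simp [hp, ha, g, Set.indicator]
    · have h1 : (1 : ℝ) ≤ n := by exact_mod_cast hn0
      have h2 : (n : ℝ) ≤ (n : ℝ) ^ s := by
        simpa using Real.rpow_le_rpow_of_exponent_le h1 hs.1.le
      have h3 := ArithmeticFunction.vonMangoldt.residueClass_nonneg (a : ZMod m) n
      rw [Set.indicator_of_notMem (fun h ↦ hp h.1), zero_add]
      simp only [g, if_neg hp]
      gcongr
  have hsum : Summable fun n : ℕ ↦
      ArithmeticFunction.vonMangoldt.residueClass (a : ZMod m) n / (n : ℝ) ^ s :=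
    Summable.of_nonneg_of_le (fun n ↦ div_nonneg
      (ArithmeticFunction.vonMangoldt.residueClass_nonneg _ n) (by positivity)) key (hS.add hK)
  have h1 := hsum.tsum_le_tsum key (hS.add hK)
  rw [hS.tsum_add hK] at h1
  linarith [hC hs]

/-- The primes whose residue modulo `m` lies in `B`. -/
def primesInClasses {m : ℕ} (B : Finset (ZMod m)ˣ) : Set ℕ :=
  {n | n.Prime ∧ ∃ a ∈ B, (n : ZMod m) = a}

lemma primesInClasses_log_sum_lower {m : ℕ} [NeZero m] (B : Finset (ZMod m)ˣ) :
    ∃ C : ℝ, ∀ s ∈ Set.Ioc (1 : ℝ) 2, (B.card / m.totient : ℝ) / (s - 1) - C ≤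
      ∑' n : ℕ, (primesInClasses B).indicator
        (fun n : ℕ ↦ Real.log n * ((n : ℝ) ^ s)⁻¹) n := by
  choose C hC using fun a : (ZMod m)ˣ ↦ primes_in_class_log_sum_lower a
  refine ⟨∑ a ∈ B, C a, fun s hs ↦ ?_⟩
  have hS (a : (ZMod m)ˣ) : Summable ({n : ℕ | n.Prime ∧ (n : ZMod m) = a}.indicator
      (fun n : ℕ ↦ Real.log n * ((n : ℝ) ^ s)⁻¹)) := (summable_log_mul_rpow_inv hs.1).indicator _
  have hU : primesInClasses B = ⋃ a ∈ B, {n : ℕ | n.Prime ∧ (n : ZMod m) = a} := by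
    ext n; simp [primesInClasses]
  have hind (n : ℕ) : (primesInClasses B).indicator
        (fun n : ℕ ↦ Real.log n * ((n : ℝ) ^ s)⁻¹) n =
      ∑ a ∈ B, {n : ℕ | n.Prime ∧ (n : ZMod m) = a}.indicator
        (fun n : ℕ ↦ Real.log n * ((n : ℝ) ^ s)⁻¹) n := by
    rw [hU, Finset.indicator_biUnion_apply]
    intro a _ b _ hab
    refine Set.disjoint_left.2 fun n h1 h2 ↦ hab (Units.ext ?_)
    exact h1.2.symm.trans h2.2
  simp_rw [hind]
  rw [Summable.tsum_finsetSum fun a _ ↦ hS a]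
  refine le_trans (le_of_eq ?_) (sum_le_sum fun a _ ↦ hC a s hs)
  rw [sum_sub_distrib, sum_const, nsmul_eq_mul]
  ring

/-- If the classes in `B` make up at least half of all the reduced classes, then the reciprocal
sum over the corresponding primes is large. -/
lemma primesInClasses_sum_lower {m : ℕ} [NeZero m] (B : Finset (ZMod m)ˣ)
    (hB : (m.totient : ℝ) / 2 ≤ B.card) :
    ∃ C : ℝ, ∀ J : ℕ, (J : ℝ) / 4 - C ≤
      ∑' n : ℕ, (primesInClasses B).indicator
        (fun n : ℕ ↦ ((n : ℝ) ^ (1 + ((2 : ℝ) ^ J)⁻¹))⁻¹) n := by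
  obtain ⟨C, hC⟩ := primesInClasses_log_sum_lower B
  set Q := primesInClasses B
  have hm : (0 : ℝ) < m.totient := by exact_mod_cast Nat.totient_pos.2 (NeZero.pos m)
  have hB' : (1 : ℝ) / 2 ≤ B.card / m.totient := by
    rw [le_div_iff₀ hm]; linarith
  suffices h : ∀ J : ℕ, (J : ℝ) / 4 - |C| * (1 - ((2 : ℝ) ^ J)⁻¹) ≤
      ∑' n : ℕ, Q.indicator (fun n : ℕ ↦ ((n : ℝ) ^ (1 + ((2 : ℝ) ^ J)⁻¹))⁻¹) n by
    refine ⟨|C|, fun J ↦ le_trans ?_ (h J)⟩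
    have : 0 ≤ |C| * ((2 : ℝ) ^ J)⁻¹ := by positivity
    linarith
  intro J
  induction J with
  | zero =>
    simp only [CharP.cast_eq_zero, zero_div, pow_zero, inv_one, sub_self, mul_zero]
    exact tsum_nonneg fun n ↦ Set.indicator_nonneg (fun _ _ ↦ by positivity) _
  | succ J ih =>
    set d : ℝ := ((2 : ℝ) ^ (J + 1))⁻¹ with hd
    have hd0 : 0 < d := by positivity
    have hd2 : ((2 : ℝ) ^ J)⁻¹ = 2 * d := by rw [hd, pow_succ]; field_simp
    have hd1 : 2 * d ≤ 1 := by
      rw [← hd2]; exact inv_le_one_of_one_le₀ (one_le_pow₀ (by norm_num))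
    rw [hd2] at ih
    have hs1 : Summable (Q.indicator (fun n : ℕ ↦ ((n : ℝ) ^ (1 + 2 * d))⁻¹)) :=
      (Real.summable_nat_rpow_inv.2 (by linarith)).indicator _
    have hs2 : Summable (Q.indicator (fun n : ℕ ↦ ((n : ℝ) ^ (1 + d))⁻¹)) :=
      (Real.summable_nat_rpow_inv.2 (by linarith)).indicator _
    have hs3 : Summable (Q.indicator (fun n : ℕ ↦ Real.log n * ((n : ℝ) ^ (1 + 2 * d))⁻¹)) :=
      (summable_log_mul_rpow_inv (by linarith)).indicator _
    have hle := (hs1.add (hs3.mul_left d)).tsum_le_tsum (g := Q.indicator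
      (fun n : ℕ ↦ ((n : ℝ) ^ (1 + d))⁻¹)) (fun n ↦ ?_) hs2
    · rw [hs1.tsum_add (hs3.mul_left d), tsum_mul_left] at hle
      have h1 := hC (1 + 2 * d) ⟨by linarith, by linarith⟩
      rw [add_sub_cancel_left] at h1
      have h2 : (1 : ℝ) / 2 / (2 * d) - |C| ≤ (B.card / m.totient : ℝ) / (2 * d) - C := by
        gcongr; exact le_abs_self C
      have h3 := mul_le_mul_of_nonneg_left (h2.trans h1) hd0.le
      have h4 : d * ((1 : ℝ) / 2 / (2 * d) - |C|) = 1 / 4 - |C| * d := by field_simp; ring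
      rw [h4] at h3
      push_cast
      linarith
    · by_cases hn : n ∈ Q
      · simp only [hn, Set.indicator_of_mem]
        have hn0 : (0 : ℝ) < n := by exact_mod_cast hn.1.pos
        have h1 : ((n : ℝ) ^ (1 + d))⁻¹ = ((n : ℝ) ^ (1 + 2 * d))⁻¹ * Real.exp (Real.log n * d) := by
          rw [← Real.rpow_def_of_pos hn0, ← Real.rpow_neg hn0.le, ← Real.rpow_neg hn0.le,
            ← Real.rpow_add hn0]
          ring_nf
        rw [h1]
        have h2 := Real.add_one_le_exp (Real.log n * d)
        have h3 : 0 ≤ ((n : ℝ) ^ (1 + 2 * d))⁻¹ := by positivity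
        nlinarith [mul_le_mul_of_nonneg_left h2 h3]
      · simp [hn]

open scoped Classical in
/-- Integers without prime factors in `B`, where `B` comprises at least half of the reduced classes,
have counting function `O(x / (log x) ^ (1 / 4))`. -/
lemma card_avoiding_classes_le {m : ℕ} [NeZero m] (B : Finset (ZMod m)ˣ)
    (hB : (m.totient : ℝ) / 2 ≤ B.card) :
    ∃ C : ℝ, 0 ≤ C ∧ ∃ x₀ : ℝ, ∀ x : ℝ, x₀ ≤ x →
      (((Finset.Icc 1 ⌊x⌋₊).filter
        (· ∈ {n : ℕ | ∀ p, p.Prime → p ∣ n → p ∉ primesInClasses B})).card : ℝ) ≤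
        C * (x / Real.log x ^ (1 / 4 : ℝ)) := by
  obtain ⟨C, hC⟩ := primesInClasses_sum_lower B hB
  have hz := tendsto_sub_mul_tsum_nat_rpow.eventually (eventually_le_nhds (one_lt_two))
  rw [eventually_nhdsWithin_iff, Metric.eventually_nhds_iff] at hz
  obtain ⟨ε, hε, hz⟩ := hz
  refine ⟨4 * (Real.log 4 + 5) * Real.exp 1 * Real.exp C, by positivity,
    Real.exp (1 + ε⁻¹), fun x hx ↦ ?_⟩
  have hx0 : 0 < x := (Real.exp_pos _).trans_le hx
  set ℓ := Real.log x with hℓ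
  have hℓ1 : 1 + ε⁻¹ ≤ ℓ := (Real.le_log_iff_exp_le hx0).2 hx
  have hεi : 0 < ε⁻¹ := by positivity
  have hℓ0 : 0 < ℓ := by linarith
  have hx1 : 1 ≤ x := by
    have := Real.add_one_le_exp (1 + ε⁻¹); linarith
  obtain ⟨k, hk1, hk2⟩ := exists_nat_pow_near (show (1 : ℝ) ≤ ℓ by linarith) one_lt_two
  set J := k + 1 with hJ
  have hJ2 : (2 : ℝ) ^ J ≤ 2 * ℓ := by rw [hJ, pow_succ]; linarith
  set d : ℝ := ((2 : ℝ) ^ J)⁻¹ with hd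
  have hd0 : 0 < d := by positivity
  have hdℓ : d * ℓ ≤ 1 := by
    rw [hd, inv_mul_le_one₀ (by positivity)]; exact hk2.le
  have hdε : d < ε := by
    have : ε⁻¹ < (2 : ℝ) ^ J := by linarith
    rw [hd]; exact inv_lt_of_inv_lt₀ hε this
  have hs : 1 < 1 + d := by linarith
  set Q := primesInClasses B with hQ
  set A : Set ℕ := {n : ℕ | ∀ p, p.Prime → p ∣ n → p ∉ Q} with hA
  set T := (Finset.Icc 1 ⌊x⌋₊).filter (· ∈ A) with hT
  have hcount := card_mul_log_le_of_dvd_closed A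
    (fun m n hmn hn p hp hpm ↦ hn p hp (hpm.trans hmn)) hx1
  have hZ : ∑' n : ℕ, 1 / (n : ℝ) ^ (1 + d) ≤ 4 * ℓ := by
    have := hz (y := 1 + d) (by simp [abs_of_pos hd0, hdε]) (by simp [hd0])
    rw [add_sub_cancel_left, hd, inv_mul_le_iff₀ (by positivity)] at this
    linarith
  have hE := (tsum_avoidingRpowHom_mul_exp_le (Q := Q) (fun p hp ↦ hp.1) hs).trans hZ
  have hF0 : 0 ≤ ∑' n, avoidingRpowHom Q (1 + d) (by linarith) n :=
    tsum_nonneg (avoidingRpowHom_nonneg _ _ _)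
  have hP : ℓ ^ (1 / 4 : ℝ) * Real.exp (-C) ≤
      Real.exp (∑' n, Q.indicator (fun n : ℕ ↦ ((n : ℝ) ^ (1 + d))⁻¹) n) := by
    rw [Real.rpow_def_of_pos hℓ0, ← Real.exp_add, Real.exp_le_exp]
    have h1 : Real.log ℓ ≤ J := by
      rw [Real.log_le_iff_le_exp hℓ0]
      have h2 : (2 : ℝ) ^ J ≤ Real.exp 1 ^ J :=
        pow_le_pow_left₀ (by norm_num) (by linarith [Real.add_one_le_exp (1 : ℝ)]) _
      rw [← Real.exp_nat_mul, mul_one] at h2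
      linarith
    linarith [hC J]
  have hE2 := (mul_le_mul_of_nonneg_left hP hF0).trans hE
  have hsum : ∑ n ∈ T, (n : ℝ)⁻¹ ≤
      Real.exp 1 * ∑' n, avoidingRpowHom Q (1 + d) (by linarith) n := by
    refine le_trans ?_ (mul_le_mul_of_nonneg_left ((summable_avoidingRpowHom Q hs).sum_le_tsum T
      fun n _ ↦ avoidingRpowHom_nonneg _ _ _ _) (Real.exp_pos 1).le)
    rw [mul_sum]
    refine sum_le_sum fun n hn ↦ ?_
    simp only [hT, mem_filter, mem_Icc] at hn
    have hn0 : (0 : ℝ) < n := by exact_mod_cast hn.1.1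
    have hnx : (n : ℝ) ≤ x := (Nat.le_floor_iff hx0.le).1 hn.1.2
    rw [avoidingRpowHom_apply, if_pos (c := ∀ p : ℕ, p.Prime → p ∣ n → p ∉ Q) hn.2,
      Real.rpow_add hn0, Real.rpow_one, mul_inv, mul_left_comm]
    refine le_mul_of_one_le_right (by positivity) ?_
    rw [← div_eq_mul_inv, one_le_div (by positivity), Real.rpow_def_of_pos hn0, Real.exp_le_exp]
    calc Real.log n * d ≤ ℓ * d := by gcongr; exact Real.log_le_log hn0 hnx
      _ ≤ 1 := by linarith
  set F := ∑' n, avoidingRpowHom Q (1 + d) (by linarith) n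
  have hr : 0 < ℓ ^ (1 / 4 : ℝ) := by positivity
  have hFle : F ≤ 4 * ℓ * Real.exp C / ℓ ^ (1 / 4 : ℝ) := by
    rw [le_div_iff₀ hr]
    rw [Real.exp_neg, ← mul_assoc, ← div_eq_mul_inv, div_le_iff₀ (Real.exp_pos C)] at hE2
    exact hE2
  have hlog4 : 0 < Real.log 4 := Real.log_pos (by norm_num)
  refine le_of_mul_le_mul_right (hcount.trans ?_) hℓ0
  calc _ ≤ (Real.log 4 + 5) * x * (Real.exp 1 * (4 * ℓ * Real.exp C / ℓ ^ (1 / 4 : ℝ))) := by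
        gcongr; exact hsum.trans (by gcongr)
    _ = _ := by ring

/-- The residues modulo `∏ p ∈ S, p` that are congruent to `1` modulo some `p ∈ S` form at least
half of the reduced residues, provided `∏ p ∈ S, (1 - 1 / p) ≤ 1 / 2`. -/
lemma exists_classes_one_mod_prime (S : Finset ℕ) (hS : ∀ p ∈ S, p.Prime)
    (hprod : ∏ p ∈ S, (1 - (p : ℝ)⁻¹) ≤ 1 / 2) :
    ∃ B : Finset (ZMod (∏ p : S, (p : ℕ)))ˣ,
      ((∏ p : S, (p : ℕ)).totient : ℝ) / 2 ≤ B.card ∧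
      ∀ q ∈ primesInClasses B, ∃ p ∈ S, p ∣ q - 1 := by
  classical
  set m := ∏ p : S, (p : ℕ) with hm
  have : NeZero m := ⟨prod_ne_zero_iff.2 fun p _ ↦ (hS p p.2).ne_zero⟩
  have (p : S) : Fact (p : ℕ).Prime := ⟨hS p p.2⟩
  have hcop : Pairwise (Function.onFun Nat.Coprime fun p : S ↦ (p : ℕ)) := fun p q hpq ↦
    (Nat.coprime_primes (hS p p.2) (hS q q.2)).2 fun h ↦ hpq (Subtype.ext h)
  let e : (ZMod m)ˣ ≃ Π p : S, (ZMod p)ˣ :=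
    ((Units.mapEquiv (ZMod.prodEquivPi (fun p : S ↦ (p : ℕ)) hcop).toMulEquiv).trans
      MulEquiv.piUnits).toEquiv
  have he (u : (ZMod m)ˣ) (p : S) : ((e u p : (ZMod p)ˣ) : ZMod p) =
      ZMod.castHom (dvd_prod_of_mem (fun p : S ↦ (p : ℕ)) (mem_univ p)) _ (u : ZMod m) :=
    ZMod.prodEquivPi_apply _ hcop _ _
  let G : Finset (ZMod m)ˣ := univ.filter fun u ↦ ∀ p, e u p ≠ 1
  have hG : G.card = ∏ p : S, ((p : ℕ) - 1 - 1) := by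
    have h1 : G.map e.toEmbedding = Fintype.piFinset fun p : S ↦ univ.erase (1 : (ZMod p)ˣ) := by
      ext f
      simp only [mem_map_equiv, Fintype.mem_piFinset, mem_erase, mem_univ, and_true, G,
        mem_filter, true_and, Equiv.apply_symm_apply]
    rw [← card_map e.toEmbedding, h1, Fintype.card_piFinset]
    refine prod_congr rfl fun p _ ↦ ?_
    rw [card_erase_of_mem (mem_univ _), card_univ, ZMod.card_units_eq_totient,
      Nat.totient_prime (hS p p.2)]
  have htot : m.totient = ∏ p : S, ((p : ℕ) - 1) := by
    rw [← ZMod.card_units_eq_totient, Fintype.card_congr e, Fintype.card_pi]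
    refine prod_congr rfl fun p _ ↦ ?_
    rw [ZMod.card_units_eq_totient, Nat.totient_prime (hS p p.2)]
  have hGle : (G.card : ℝ) ≤ m.totient / 2 := by
    have h1 : (G.card : ℝ) ≤ ∏ p : S, ((((p : ℕ) - 1 : ℕ) : ℝ) * (1 - (p : ℝ)⁻¹)) := by
      rw [hG, Nat.cast_prod]
      refine prod_le_prod (fun _ _ ↦ by positivity) fun p _ ↦ ?_
      have h2 := (hS p p.2).two_le
      have h2' : (2 : ℝ) ≤ p := by exact_mod_cast h2
      rw [Nat.sub_sub, Nat.cast_sub (by omega), Nat.cast_sub (by omega)]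
      have h3 : (p : ℝ) * (p : ℝ)⁻¹ = 1 := mul_inv_cancel₀ (by linarith)
      have h4 : 0 ≤ (p : ℝ)⁻¹ := by positivity
      push_cast
      nlinarith
    rw [prod_mul_distrib, ← Nat.cast_prod, ← htot,
      prod_coe_sort S fun p : ℕ ↦ (1 - (p : ℝ)⁻¹)] at h1
    have := mul_le_mul_of_nonneg_left hprod (Nat.cast_nonneg (α := ℝ) m.totient)
    linarith
  refine ⟨Gᶜ, ?_, ?_⟩
  · have h1 := card_add_card_compl G
    rw [ZMod.card_units_eq_totient] at h1
    have h2 : (G.card : ℝ) + Gᶜ.card = m.totient := by exact_mod_cast h1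
    linarith
  · rintro q ⟨hq, a, ha, hqa⟩
    simp only [G, mem_compl, mem_filter, mem_univ, true_and, not_forall, not_not] at ha
    obtain ⟨p, hp⟩ := ha
    refine ⟨p, p.2, ?_⟩
    have h1 := he a p
    rw [hp, ← hqa, map_natCast, Units.val_one] at h1
    have h2 : ((1 : ℕ) : ZMod p) = (q : ℕ) := by simpa using h1
    exact (Nat.modEq_iff_dvd' hq.one_le).1 ((ZMod.natCast_eq_natCast_iff _ _ _).1 h2)

lemma exists_prod_primesBelow_le {δ : ℝ} (hδ : 0 < δ) :
    ∃ y : ℕ, ∏ p ∈ y.primesBelow, (1 - (p : ℝ)⁻¹) ≤ δ := by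
  have h := (not_summable_iff_tendsto_nat_atTop_of_nonneg fun n ↦
    Set.indicator_nonneg (fun _ _ ↦ by positivity) n).1 not_summable_one_div_on_primes
  obtain ⟨y, hy⟩ := (h.eventually_ge_atTop (-Real.log δ)).exists
  refine ⟨y, ?_⟩
  have hsum : ∑ i ∈ range y, ({p | p.Prime} : Set ℕ).indicator (fun n : ℕ ↦ (1 : ℝ) / n) i =
      ∑ p ∈ y.primesBelow, (p : ℝ)⁻¹ := by
    rw [Nat.primesBelow, sum_filter]
    exact sum_congr rfl fun i _ ↦ by simp [Set.indicator]
  rw [hsum] at hy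
  calc ∏ p ∈ y.primesBelow, (1 - (p : ℝ)⁻¹) ≤ ∏ p ∈ y.primesBelow, Real.exp (-(p : ℝ)⁻¹) := by
        refine prod_le_prod (fun p hp ↦ ?_) fun p _ ↦ Real.one_sub_le_exp_neg _
        have := (Nat.mem_primesBelow.1 hp).2.one_lt
        exact sub_nonneg.2 (inv_le_one_of_one_le₀ (by exact_mod_cast this.le))
    _ = Real.exp (-∑ p ∈ y.primesBelow, (p : ℝ)⁻¹) := by rw [← Real.exp_sum, sum_neg_distrib]
    _ ≤ Real.exp (Real.log δ) := Real.exp_le_exp.2 (by linarith)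
    _ = δ := Real.exp_log hδ

lemma card_forall_not_dvd_totient_le (S : Finset ℕ) (hS : ∀ p ∈ S, p.Prime)
    (hprod : ∏ p ∈ S, (1 - (p : ℝ)⁻¹) ≤ 1 / 2) :
    ∃ C : ℝ, 0 ≤ C ∧ ∃ x₀ : ℝ, ∀ x : ℝ, x₀ ≤ x →
      (((Finset.Icc 1 ⌊x⌋₊).filter fun n ↦ ∀ p ∈ S, ¬ p ∣ n.totient).card : ℝ) ≤
        C * (x / Real.log x ^ (1 / 4 : ℝ)) := by
  classical
  obtain ⟨B, hB, hBS⟩ := exists_classes_one_mod_prime S hS hprod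
  have : NeZero (∏ p : S, (p : ℕ)) := ⟨prod_ne_zero_iff.2 fun p _ ↦ (hS p p.2).ne_zero⟩
  obtain ⟨C, hC0, x₀, h⟩ := card_avoiding_classes_le B hB
  refine ⟨C, hC0, x₀, fun x hx ↦ le_trans ?_ (h x hx)⟩
  refine Nat.cast_le.2 (card_le_card fun n hn ↦ ?_)
  rw [mem_filter] at hn ⊢
  refine ⟨hn.1, fun q hq hqn hqB ↦ ?_⟩
  obtain ⟨p, hpS, hpq⟩ := hBS q hqB
  refine hn.2 p hpS (hpq.trans ?_)
  rw [← Nat.totient_prime hq]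
  exact Nat.totient_dvd_of_dvd hqn

lemma prod_primesBelow_not_dvd_le {M y : ℕ} (hM : M ≠ 0) {c : ℝ} (hc : 0 < c)
    (hcM : c * M ≤ M.totient) (hy : ∏ p ∈ y.primesBelow, (1 - (p : ℝ)⁻¹) ≤ c / 2) :
    ∏ p ∈ y.primesBelow with ¬ p ∣ M, (1 - (p : ℝ)⁻¹) ≤ 1 / 2 := by
  have hfac {p : ℕ} (hp : p.Prime) : 0 ≤ 1 - (p : ℝ)⁻¹ :=
    sub_nonneg.2 (inv_le_one_of_one_le₀ (by exact_mod_cast hp.one_lt.le))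
  have hM0 : (0 : ℝ) < M := by exact_mod_cast Nat.pos_of_ne_zero hM
  have h1 : (M.totient : ℝ) = M * ∏ p ∈ M.primeFactors, (1 - (p : ℝ)⁻¹) := by
    have := congrArg (Rat.cast : ℚ → ℝ) (Nat.totient_eq_mul_prod_factors M)
    push_cast at this
    exact this
  have h2 : c ≤ ∏ p ∈ M.primeFactors, (1 - (p : ℝ)⁻¹) := by
    rw [h1, mul_comm] at hcM
    exact le_of_mul_le_mul_left hcM hM0
  have h3 : ∏ p ∈ M.primeFactors, (1 - (p : ℝ)⁻¹) ≤
      ∏ p ∈ y.primesBelow with p ∣ M, (1 - (p : ℝ)⁻¹) := by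
    refine prod_le_prod_of_subset_of_le_one (fun p hp ↦ ?_) (fun p hp ↦ ?_) fun p hp _ ↦ ?_
    · rw [mem_filter, Nat.mem_primesBelow] at hp
      exact Nat.mem_primeFactors.2 ⟨hp.1.2, hp.2, hM⟩
    · exact hfac (Nat.prime_of_mem_primeFactors hp)
    · have : 0 ≤ (p : ℝ)⁻¹ := by positivity
      linarith
  have h4 : 0 ≤ ∏ p ∈ y.primesBelow with ¬ p ∣ M, (1 - (p : ℝ)⁻¹) :=
    prod_nonneg fun p hp ↦ hfac (Nat.mem_primesBelow.1 (mem_filter.1 hp).1).2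
  rw [← prod_filter_mul_prod_filter_not _ (· ∣ M)] at hy
  have h5 := (mul_le_mul_of_nonneg_right (h2.trans h3) h4).trans hy
  refine le_of_mul_le_mul_left ?_ hc
  linarith

/-- The set of `n` with `φ (φ n) ≥ c n` saves a fixed power of `log x`, independent of `c`. -/
lemma card_totient_totient_ge_le {c : ℝ} (hc : 0 < c) :
    ∃ C : ℝ, 0 ≤ C ∧ ∃ x₀ : ℝ, ∀ x : ℝ, x₀ ≤ x →
      (((Finset.Icc 1 ⌊x⌋₊).filter fun n : ℕ ↦ c * (n : ℝ) ≤ n.totient.totient).card : ℝ) ≤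
        C * (x / Real.log x ^ (1 / 4 : ℝ)) := by
  classical
  obtain ⟨y, hy⟩ := exists_prod_primesBelow_le (half_pos hc)
  let P := y.primesBelow.powerset.filter fun S : Finset ℕ ↦ ∏ p ∈ S, (1 - (p : ℝ)⁻¹) ≤ 1 / 2
  have hP (S : P) := card_forall_not_dvd_totient_le S.1
    (fun p hp ↦ (Nat.mem_primesBelow.1 (mem_powerset.1 (mem_filter.1 S.2).1 hp)).2)
    (mem_filter.1 S.2).2
  choose C hC0 x₀ h using hP
  refine ⟨∑ S, C S, sum_nonneg fun S _ ↦ hC0 S, ∑ S, |x₀ S|, fun x hx ↦ ?_⟩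
  rw [sum_mul]
  refine le_trans ?_ (sum_le_sum fun S _ ↦ h S x (le_trans ((le_abs_self _).trans
    (single_le_sum (f := fun S ↦ |x₀ S|) (fun _ _ ↦ abs_nonneg _) (mem_univ S))) hx))
  rw [← Nat.cast_sum]
  refine Nat.cast_le.2 (le_trans (card_le_card fun n hn ↦ ?_) card_biUnion_le)
  rw [mem_filter] at hn
  have hn1 := (mem_Icc.1 hn.1).1
  have hcn : c * n.totient ≤ n.totient.totient := by
    refine le_trans ?_ hn.2
    gcongr
    exact Nat.totient_le n
  refine mem_biUnion.2 ⟨⟨y.primesBelow.filter (¬ · ∣ n.totient), mem_filter.2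
    ⟨mem_powerset.2 (filter_subset _ _),
      prod_primesBelow_not_dvd_le (Nat.totient_pos.2 hn1).ne' hc hcn hy⟩⟩, mem_univ _, ?_⟩
  exact mem_filter.2 ⟨hn.1, fun p hp ↦ (mem_filter.1 hp).2⟩

lemma totient_iterate_le_totient_totient {k : ℕ} (hk : 1 ≤ k) (n : ℕ) :
    Nat.totient^[k + 1] n ≤ n.totient.totient := by
  obtain ⟨j, rfl⟩ := Nat.exists_eq_add_of_le' hk
  exact Function.iterate_le_id_of_le_id (fun n ↦ Nat.totient_le n) j n.totient.totient

/-- There exists an absolute constant `c₁` with `0 < c₁ ≤ 1` such that for every real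
constant `c` with `0 < c < 1/2` there exist a constant `C > 0` and a threshold `x₀` such
that for every `x ≥ x₀` and every integer `k` with
`1 ≤ k ≤ (log log x)/(log log log log x)`, the number of positive integers `n ≤ x` with
`φ_{k+1}(n) ≥ c·n` is at most
`(6/((k-1)!·e^{(k-1)γ}·π²)) · x/(c·(log log log x)^{k+1})
  + C · x·exp((log log log x)²) / ((log x)^{c₁}·(log log log x)²)`. -/
theorem iterated_totient_count_upper_bound :
    ∃ c₁ : ℝ, 0 < c₁ ∧ c₁ ≤ 1 ∧
      ∀ c : ℝ, 0 < c → c < 1 / 2 →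
        ∃ C : ℝ, 0 < C ∧ ∃ x₀ : ℝ, ∀ x : ℝ, x₀ ≤ x →
          ∀ k : ℕ, 1 ≤ k →
            (k : ℝ) ≤ Real.log (Real.log x) / Real.log (Real.log (Real.log (Real.log x))) →
            (((Finset.Icc 1 ⌊x⌋₊).filter
                (fun n : ℕ => c * (n : ℝ) ≤ (Nat.totient^[k + 1] n : ℝ))).card : ℝ) ≤
              6 / ((Nat.factorial (k - 1) : ℝ) *
                    Real.exp (((k : ℝ) - 1) * Real.eulerMascheroniConstant) * π ^ 2) *
                  (x / (c * Real.log (Real.log (Real.log x)) ^ (k + 1))) +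
                C * (x * Real.exp (Real.log (Real.log (Real.log x)) ^ 2) /
                  (Real.log x ^ c₁ * Real.log (Real.log (Real.log x)) ^ 2)) := by
  refine ⟨1 / 4, by norm_num, by norm_num, fun c hc _ ↦ ?_⟩
  obtain ⟨C, hC0, x₀, h⟩ := card_totient_totient_ge_le hc
  refine ⟨C + 1, by linarith, max x₀ (Real.exp (Real.exp (Real.exp 1))), fun x hx k hk _ ↦ ?_⟩
  have hx1 := (le_max_right _ _).trans hx
  have hx0 : 0 < x := (Real.exp_pos _).trans_le hx1
  have hl1 : Real.exp (Real.exp 1) ≤ Real.log x := (Real.le_log_iff_exp_le hx0).2 hx1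
  have hl1' : 0 < Real.log x := (Real.exp_pos _).trans_le hl1
  have hl2 : Real.exp 1 ≤ Real.log (Real.log x) := (Real.le_log_iff_exp_le hl1').2 hl1
  have hl2' : 0 < Real.log (Real.log x) := (Real.exp_pos _).trans_le hl2
  have hl3 : 1 ≤ Real.log (Real.log (Real.log x)) := (Real.le_log_iff_exp_le hl2').2 hl2
  set t := Real.log (Real.log (Real.log x))
  have ht : 0 < t := by linarith
  have hcount : (((Finset.Icc 1 ⌊x⌋₊).filter
      (fun n : ℕ => c * (n : ℝ) ≤ (Nat.totient^[k + 1] n : ℝ))).card : ℝ) ≤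
      C * (x / Real.log x ^ (1 / 4 : ℝ)) := by
    refine le_trans (Nat.cast_le.2 (card_le_card fun n hn ↦ ?_)) (h x ((le_max_left _ _).trans hx))
    rw [mem_filter] at hn ⊢
    exact ⟨hn.1, hn.2.trans (Nat.cast_le.2 (totient_iterate_le_totient_totient hk n))⟩
  have herr : x / Real.log x ^ (1 / 4 : ℝ) ≤
      x * Real.exp (t ^ 2) / (Real.log x ^ (1 / 4 : ℝ) * t ^ 2) := by
    rw [mul_div_mul_comm]
    refine le_mul_of_one_le_right (by positivity) ?_
    rw [one_le_div (by positivity)]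
    linarith [Real.add_one_le_exp (t ^ 2)]
  have hmain : 0 ≤ 6 / ((Nat.factorial (k - 1) : ℝ) *
      Real.exp (((k : ℝ) - 1) * Real.eulerMascheroniConstant) * π ^ 2) *
        (x / (c * t ^ (k + 1))) := by positivity
  have h1 : C * (x / Real.log x ^ (1 / 4 : ℝ)) ≤
      (C + 1) * (x * Real.exp (t ^ 2) / (Real.log x ^ (1 / 4 : ℝ) * t ^ 2)) :=
    mul_le_mul (by linarith) herr (by positivity) (by linarith)
  linarith
end

section
/- Fix an integer k ≥ 0 and a real constant c > 0. There exists a constant C > 0 such that for all sufficiently large real x, the number of positive integers n ≤ x satisfying φ_{k+1}(n) ≥ c·n is at most (6/(k!·e^{kγ}·π²)) · x/(c·(log log log x)^k) + C · x/(c·(log log log x)^{k+1}·(log log x)·(log x)). -/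
open Real Finset

/-- The primes `q ≤ N` with `q ≡ 1 (mod p)`. -/
def primesOneMod (p N : ℕ) : Finset ℕ :=
  {q ∈ Finset.Ioc 0 N | q.Prime ∧ (q : ZMod p) = 1}

theorem exists_le_tsum_log_div_rpow (p : ℕ) [NeZero p] :
    ∃ δ C : ℝ, 0 < δ ∧ 0 ≤ C ∧ ∀ η : ℝ, 0 < η → η ≤ 1 →
      δ / η - C ≤ ∑' n : ℕ,
        (if n.Prime ∧ (n : ZMod p) = 1 then (1 : ℝ) else 0) * Real.log n / (n : ℝ) ^ (1 + η) := by
  obtain ⟨C, hC⟩ := ArithmeticFunction.vonMangoldt.LSeries_residueClass_lower_bound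
    (isUnit_one : IsUnit (1 : ZMod p))
  set R := ArithmeticFunction.vonMangoldt.residueClass (1 : ZMod p) with hR
  have hR0 : ∀ n, 0 ≤ R n := ArithmeticFunction.vonMangoldt.residueClass_nonneg _
  have hs := ArithmeticFunction.vonMangoldt.summable_residueClass_non_primes_div (1 : ZMod p)
  set D := ∑' n : ℕ, (if n.Prime then 0 else R n) / (n : ℝ) with hD
  have hnp (n : ℕ) : 0 ≤ (if n.Prime then 0 else R n) := by
    split_ifs
    exacts [le_rfl, hR0 n]
  have hD0 : 0 ≤ D := tsum_nonneg fun n => div_nonneg (hnp n) n.cast_nonneg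
  refine ⟨(p.totient : ℝ)⁻¹, |C| + D, ?_, by positivity, fun η h0 h1 => ?_⟩
  · have := Nat.totient_pos.2 (NeZero.pos p)
    positivity
  have hb := @hC (1 + η) ⟨by linarith, by linarith⟩
  have hle (n : ℕ) : (if n.Prime then 0 else R n) / (n : ℝ) ^ (1 + η) ≤
      (if n.Prime then 0 else R n) / (n : ℝ) := by
    rcases Nat.eq_zero_or_pos n with rfl | hn
    · simp [Real.zero_rpow (by linarith : 1 + η ≠ 0)]
    · have hn1 : (1 : ℝ) ≤ n := by exact_mod_cast hn
      refine div_le_div_of_nonneg_left (hnp n) (by linarith) ?_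
      simpa using Real.rpow_le_rpow_of_exponent_le hn1 (by linarith : (1 : ℝ) ≤ 1 + η)
  have hs' : Summable fun n : ℕ => (if n.Prime then 0 else R n) / (n : ℝ) ^ (1 + η) :=
    Summable.of_nonneg_of_le (fun n => div_nonneg (hnp n) (by positivity)) hle hs
  have hlog (n : ℕ) : R n / (n : ℝ) ^ (1 + η) =
      (if n.Prime then 0 else R n) / (n : ℝ) ^ (1 + η) +
      (if n.Prime ∧ (n : ZMod p) = 1 then (1 : ℝ) else 0) * Real.log n / (n : ℝ) ^ (1 + η) := by
    by_cases hn : n.Prime <;> by_cases h : (n : ZMod p) = 1 <;>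
      simp [R, hn, h, ArithmeticFunction.vonMangoldt_apply_prime]
  have hlogle : (∑' n : ℕ, R n / (n : ℝ) ^ (1 + η)) ≤ D + ∑' n : ℕ,
        (if n.Prime ∧ (n : ZMod p) = 1 then (1 : ℝ) else 0) * Real.log n / (n : ℝ) ^ (1 + η) := by
    by_cases hsum : Summable fun n : ℕ => R n / (n : ℝ) ^ (1 + η)
    · rw [tsum_congr hlog, Summable.tsum_add hs']
      · gcongr
        exact hs'.tsum_le_tsum hle hs
      · refine (hsum.sub hs').congr fun n => ?_
        rw [hlog n]; ring
    · rw [tsum_eq_zero_of_not_summable hsum]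
      refine add_nonneg hD0 (tsum_nonneg fun n => ?_)
      have := Real.log_natCast_nonneg n
      positivity
  rw [add_sub_cancel_left, div_eq_mul_inv] at hb
  have := le_abs_self C
  rw [div_eq_mul_inv]
  linarith

theorem le_tsum_div_rpow_of_le_tsum_log_div_rpow {a : ℕ → ℝ} (ha0 : ∀ n, 0 ≤ a n)
    (ha1 : ∀ n, a n ≤ 1) {δ C : ℝ} (hC : 0 ≤ C)
    (h : ∀ η : ℝ, 0 < η → η ≤ 1 → δ / η - C ≤ ∑' n : ℕ, a n * Real.log n / (n : ℝ) ^ (1 + η))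
    (j : ℕ) :
    δ / 2 * j - C ≤ ∑' n : ℕ, a n / (n : ℝ) ^ (1 + (1 / 2 : ℝ) ^ j) := by
  have hsum (η : ℝ) (hη : 0 < η) : Summable fun n : ℕ => a n / (n : ℝ) ^ (1 + η) :=
    Summable.of_nonneg_of_le (fun n => div_nonneg (ha0 n) (by positivity))
      (fun n => div_le_div_of_nonneg_right (ha1 n) (by positivity))
      (Real.summable_one_div_nat_rpow.2 (by linarith))
  have hstep (η : ℝ) (hη : 0 < η) (h2 : 2 * η ≤ 1) :
      (∑' n : ℕ, a n / (n : ℝ) ^ (1 + 2 * η)) + δ / 2 - C * η ≤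
        ∑' n : ℕ, a n / (n : ℝ) ^ (1 + η) := by
    have hpt (n : ℕ) : η * (a n * Real.log n / (n : ℝ) ^ (1 + 2 * η)) ≤
        a n / (n : ℝ) ^ (1 + η) - a n / (n : ℝ) ^ (1 + 2 * η) := by
      rcases Nat.eq_zero_or_pos n with rfl | hn
      · simp [Real.zero_rpow (by linarith : 1 + η ≠ 0)]
        rw [Real.zero_rpow (by linarith : 1 + 2 * η ≠ 0)]; simp
      · have hn0 : (0 : ℝ) < n := by exact_mod_cast hn
        have e : (n : ℝ) ^ (1 + 2 * η) = (n : ℝ) ^ (1 + η) * (n : ℝ) ^ η := by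
          rw [← Real.rpow_add hn0]; ring_nf
        have hexp : 1 + η * Real.log n ≤ (n : ℝ) ^ η := by
          rw [Real.rpow_def_of_pos hn0, add_comm, mul_comm]
          exact Real.add_one_le_exp _
        have h1 : 0 < (n : ℝ) ^ (1 + η) := by positivity
        have h2 : 0 < (n : ℝ) ^ η := by positivity
        have : a n / (n : ℝ) ^ (1 + η) - a n / (n : ℝ) ^ (1 + 2 * η) =
            a n * ((n : ℝ) ^ η - 1) / (n : ℝ) ^ (1 + 2 * η) := by
          rw [e]; field_simp
        rw [this, ← mul_div_assoc]
        refine div_le_div_of_nonneg_right ?_ (by positivity)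
        nlinarith [ha0 n]
    have hd := (hsum η hη).sub (hsum (2 * η) (by positivity))
    have hs : Summable fun n : ℕ => η * (a n * Real.log n / (n : ℝ) ^ (1 + 2 * η)) := by
      refine Summable.of_nonneg_of_le (fun n => ?_) hpt hd
      have := Real.log_natCast_nonneg n
      have := ha0 n
      positivity
    have := hs.tsum_le_tsum hpt hd
    rw [(hsum η hη).tsum_sub (hsum (2 * η) (by positivity)), tsum_mul_left] at this
    have h3 := mul_le_mul_of_nonneg_left (h (2 * η) (by positivity) h2) hη.le
    have h4 : η * (δ / (2 * η) - C) = δ / 2 - C * η := by field_simp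
    linarith
  suffices H : δ / 2 * j - C * (1 - (1 / 2) ^ j) ≤
      ∑' n : ℕ, a n / (n : ℝ) ^ (1 + (1 / 2 : ℝ) ^ j) by
    have : 0 ≤ C * (1 / 2) ^ j := by positivity
    linarith
  induction j with
  | zero =>
    simp only [Nat.cast_zero, mul_zero, pow_zero, sub_self]
    exact tsum_nonneg fun n => div_nonneg (ha0 n) (by positivity)
  | succ j ih =>
    have e : 2 * (1 / 2 : ℝ) ^ (j + 1) = (1 / 2) ^ j := by ring
    have := hstep ((1 / 2) ^ (j + 1)) (by positivity) (by
      rw [e]; exact pow_le_one₀ (by norm_num) (by norm_num))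
    rw [e] at this
    have e' : C * (1 - (1 / 2 : ℝ) ^ (j + 1)) = C * (1 - (1 / 2) ^ j) + C * (1 / 2) ^ (j + 1) := by
      ring
    rw [e']
    push_cast
    linarith

theorem sum_Ioc_one_div_rpow_le {η : ℝ} (hη : 0 < η) {N M : ℕ} (hN : 0 < N) (hNM : N ≤ M) :
    ∑ n ∈ Ioc N M, 1 / (n : ℝ) ^ (1 + η) ≤ (N : ℝ) ^ (-η) / η - (M : ℝ) ^ (-η) / η := by
  induction M, hNM using Nat.le_induction with
  | base => simp
  | succ M hNM ih =>
    rw [← insert_Ioc_right_eq_Ioc_add_one hNM, sum_insert (by simp)]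
    have hM : (0 : ℝ) < M := by exact_mod_cast hN.trans_le hNM
    have key : (((M + 1 : ℕ) : ℝ)) ^ (-η) * (1 + η / (M + 1 : ℕ)) ≤ (M : ℝ) ^ (-η) := by
      have h1 : (M : ℝ) ≤ (M + 1 : ℕ) * Real.exp (-(1 / (M + 1 : ℕ))) := by
        have := Real.add_one_le_exp (-(1 / ((M + 1 : ℕ) : ℝ)))
        have h2 := mul_le_mul_of_nonneg_left this (by positivity : (0 : ℝ) ≤ (M + 1 : ℕ))
        refine le_trans (le_of_eq ?_) h2
        push_cast; field_simp; ring
      have h2 := Real.rpow_le_rpow_of_nonpos hM h1 (by linarith : -η ≤ 0)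
      rw [Real.mul_rpow (by positivity) (by positivity), ← Real.exp_mul] at h2
      refine le_trans ?_ h2
      gcongr
      have := Real.add_one_le_exp (-(1 / ((M + 1 : ℕ) : ℝ)) * -η)
      refine le_trans (le_of_eq ?_) this
      ring
    have e : 1 / (((M + 1 : ℕ) : ℝ)) ^ (1 + η) = ((M + 1 : ℕ) : ℝ) ^ (-η) / (M + 1 : ℕ) := by
      rw [Real.rpow_neg (by positivity), Real.rpow_add (by positivity), Real.rpow_one]
      field_simp
    have : ((M + 1 : ℕ) : ℝ) ^ (-η) / (M + 1 : ℕ) ≤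
        (M : ℝ) ^ (-η) / η - ((M + 1 : ℕ) : ℝ) ^ (-η) / η := by
      rw [← sub_div, le_div_iff₀ hη]
      have : ((M + 1 : ℕ) : ℝ) ^ (-η) / (M + 1 : ℕ) * η =
        ((M + 1 : ℕ) : ℝ) ^ (-η) * (1 + η / (M + 1 : ℕ)) - ((M + 1 : ℕ) : ℝ) ^ (-η) := by ring
      linarith
    rw [e]
    linarith

theorem tsum_div_rpow_le {a : ℕ → ℝ} (ha0 : ∀ n, 0 ≤ a n) (ha1 : ∀ n, a n ≤ 1) {η : ℝ}
    (hη : 0 < η) {N : ℕ} (hN : 0 < N) :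
    ∑' n : ℕ, a n / (n : ℝ) ^ (1 + η) ≤ ∑ n ∈ Ioc 0 N, a n / n + (N : ℝ) ^ (-η) / η := by
  have h0 (n : ℕ) : 0 ≤ a n / (n : ℝ) ^ (1 + η) := div_nonneg (ha0 n) (by positivity)
  refine Real.tsum_le_of_sum_range_le h0 fun M => ?_
  calc ∑ n ∈ range M, a n / (n : ℝ) ^ (1 + η)
      ≤ ∑ n ∈ insert 0 (Ioc 0 N ∪ Ioc N (N + M)), a n / (n : ℝ) ^ (1 + η) := by
        refine sum_le_sum_of_subset_of_nonneg (fun n hn => ?_) fun n _ _ => h0 n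
        simp only [Finset.mem_range] at hn
        simp only [Finset.mem_insert, Finset.mem_union, Finset.mem_Ioc]
        omega
    _ = ∑ n ∈ Ioc 0 N, a n / (n : ℝ) ^ (1 + η) +
          ∑ n ∈ Ioc N (N + M), a n / (n : ℝ) ^ (1 + η) := by
        rw [sum_insert (by simp), sum_union]
        · simp [Real.zero_rpow (by linarith : 1 + η ≠ 0)]
        · exact Finset.disjoint_left.2 fun n => by simp only [Finset.mem_Ioc]; omega
    _ ≤ ∑ n ∈ Ioc 0 N, a n / n + ∑ n ∈ Ioc N (N + M), 1 / (n : ℝ) ^ (1 + η) := by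
        gcongr with n hn n hn
        · exact ha0 n
        · exact_mod_cast (Finset.mem_Ioc.1 hn).1
        · have hn1 : (1 : ℝ) ≤ n := by exact_mod_cast (Finset.mem_Ioc.1 hn).1
          simpa using Real.rpow_le_rpow_of_exponent_le hn1 (by linarith : (1 : ℝ) ≤ 1 + η)
        · exact ha1 n
    _ ≤ ∑ n ∈ Ioc 0 N, a n / n + (N : ℝ) ^ (-η) / η := by
        have := sum_Ioc_one_div_rpow_le hη hN (Nat.le_add_right N M)
        have : 0 ≤ ((N + M : ℕ) : ℝ) ^ (-η) / η := by positivity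
        linarith

theorem exists_log_log_le_sum_primesOneMod (p : ℕ) [NeZero p] :
    ∃ δ : ℝ, 0 < δ ∧ ∀ᶠ x : ℝ in Filter.atTop,
      δ * Real.log (Real.log x) ≤ ∑ q ∈ primesOneMod p ⌊x⌋₊, 1 / (q : ℝ) := by
  obtain ⟨δ, C, hδ, hC, h⟩ := exists_le_tsum_log_div_rpow p
  set a : ℕ → ℝ := fun n => if n.Prime ∧ (n : ZMod p) = 1 then 1 else 0 with ha
  have ha0 (n : ℕ) : 0 ≤ a n := by positivity
  have ha1 (n : ℕ) : a n ≤ 1 := by simp only [ha]; split_ifs <;> norm_num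
  have hl4 : 0 < Real.log 4 := Real.log_pos (by norm_num)
  have hbound (j N : ℕ) (hN : 0 < N) (hj : (4 : ℝ) ^ j ≤ Real.log N) :
      δ / 2 * j - C - 1 ≤ ∑ q ∈ primesOneMod p N, 1 / (q : ℝ) := by
    have h1 := le_tsum_div_rpow_of_le_tsum_log_div_rpow ha0 ha1 hC h j
    have h2 := tsum_div_rpow_le ha0 ha1 (by positivity : (0 : ℝ) < (1 / 2) ^ j) hN
    have h3 : (N : ℝ) ^ (-(1 / 2 : ℝ) ^ j) / (1 / 2) ^ j ≤ 1 := by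
      rw [div_le_one (by positivity), Real.rpow_def_of_pos (by exact_mod_cast hN)]
      have e1 : Real.log N * -(1 / 2 : ℝ) ^ j ≤ -2 ^ j := by
        have e2 : (4 : ℝ) ^ j * (1 / 2) ^ j = 2 ^ j := by rw [← mul_pow]; norm_num
        have := mul_le_mul_of_nonneg_right hj (by positivity : (0 : ℝ) ≤ (1 / 2) ^ j)
        linarith
      refine (Real.exp_le_exp.2 e1).trans ?_
      rw [Real.exp_neg, one_div, inv_pow]
      refine inv_anti₀ (by positivity) ?_
      linarith [Real.add_one_le_exp ((2 : ℝ) ^ j)]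
    have h4 : ∑ n ∈ Ioc 0 N, a n / n = ∑ q ∈ primesOneMod p N, 1 / (q : ℝ) := by
      rw [primesOneMod, sum_filter]
      exact sum_congr rfl fun n _ => by simp only [ha]; split_ifs <;> simp
    linarith
  refine ⟨δ / (4 * Real.log 4), by positivity, ?_⟩
  have hll : Filter.Tendsto (fun x : ℝ => Real.log (Real.log x)) Filter.atTop Filter.atTop :=
    Real.tendsto_log_atTop.comp Real.tendsto_log_atTop
  filter_upwards [Filter.eventually_ge_atTop 4, Real.tendsto_log_atTop.eventually_ge_atTop 2,
    hll.eventually_ge_atTop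
      ((δ / 2 * (Real.log 2 / Real.log 4 + 1) + C + 1) * (4 * Real.log 4) / δ)] with x hx hlx hllx
  have hl : 0 < Real.log x / 2 := by linarith
  set j := ⌊Real.log (Real.log x / 2) / Real.log 4⌋₊ with hj
  have hN1 : Real.sqrt x ≤ ⌊x⌋₊ := by
    have h1 := Nat.lt_floor_add_one x
    have h2 : (2 : ℝ) ≤ Real.sqrt x := Real.le_sqrt_of_sq_le (by linarith)
    nlinarith [Real.sq_sqrt (by linarith : 0 ≤ x)]
  have hsq : 0 < Real.sqrt x := Real.sqrt_pos.2 (by linarith)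
  have hNpos : 0 < ⌊x⌋₊ := by exact_mod_cast hsq.trans_le hN1
  have hlogN : Real.log x / 2 ≤ Real.log ⌊x⌋₊ := by
    rw [← Real.log_sqrt (by linarith)]
    exact Real.log_le_log hsq hN1
  have h4j : (4 : ℝ) ^ j ≤ Real.log x / 2 := by
    rw [← Real.log_le_log_iff (by positivity) hl, Real.log_pow, ← le_div_iff₀ hl4]
    exact Nat.floor_le (div_nonneg (Real.log_nonneg (by linarith)) hl4.le)
  have hjge : (Real.log (Real.log x) - Real.log 2) / Real.log 4 - 1 ≤ j := by
    rw [← Real.log_div (by linarith) (by norm_num)]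
    linarith [Nat.lt_floor_add_one (Real.log (Real.log x / 2) / Real.log 4)]
  refine le_trans ?_ (hbound j _ hNpos (h4j.trans hlogN))
  have h5 := mul_le_mul_of_nonneg_left hjge (by positivity : 0 ≤ δ / 2)
  rw [div_le_iff₀ hδ, ← le_div_iff₀ (by positivity)] at hllx
  have h6 : δ / 2 * ((Real.log (Real.log x) - Real.log 2) / Real.log 4 - 1) =
      2 * (δ / (4 * Real.log 4) * Real.log (Real.log x)) -
        δ / 2 * (Real.log 2 / Real.log 4 + 1) := by
    field_simp; ring
  have h7 : Real.log (Real.log x) * δ / (4 * Real.log 4) =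
      δ / (4 * Real.log 4) * Real.log (Real.log x) := by ring
  linarith

/-- A second moment bound for the integers up to `N` free of prime factors from `Q`. -/
theorem card_forall_not_dvd_mul_sum_le {N : ℕ} {Q : Finset ℕ} (hQ : ∀ q ∈ Q, q.Prime)
    (hQN : Q ⊆ Ioc 0 N) :
    (#{n ∈ Ioc 0 N | ∀ q ∈ Q, ¬ q ∣ n} : ℝ) * ∑ q ∈ Q, 1 / (q : ℝ) ≤ 3 * N := by
  set S : ℝ := ∑ q ∈ Q, 1 / (q : ℝ) with hS
  have hS0 : 0 ≤ S := sum_nonneg fun q _ => by positivity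
  set w : ℕ → ℝ := fun n => ∑ q ∈ Q, if q ∣ n then 1 else 0 with hw
  have hcount (d : ℕ) : ∑ n ∈ Ioc 0 N, (if d ∣ n then (1 : ℝ) else 0) = (N / d : ℕ) := by
    rw [sum_boole, Nat.Ioc_filter_dvd_card_eq_div]
  have hfirst : N * S - N ≤ ∑ n ∈ Ioc 0 N, w n := by
    have hcard : (#Q : ℝ) ≤ N := by
      have := card_le_card hQN
      rw [Nat.card_Ioc, tsub_zero] at this
      exact_mod_cast this
    rw [hw, sum_comm]
    simp_rw [hcount]
    calc N * S - N ≤ ∑ q ∈ Q, ((N : ℝ) * (1 / q) - 1) := by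
          rw [sum_sub_distrib, ← mul_sum, sum_const, nsmul_eq_mul, mul_one]
          linarith
      _ ≤ ∑ q ∈ Q, ((N / q : ℕ) : ℝ) := by
          refine sum_le_sum fun q hq => ?_
          have hq0 : 0 < q := (hQ q hq).pos
          have h1 : (N : ℝ) ≤ q * (N / q : ℕ) + q := by
            exact_mod_cast (Nat.lt_mul_div_succ N hq0).le
          have hq' : (0 : ℝ) < q := by exact_mod_cast hq0
          rw [mul_one_div, sub_le_iff_le_add, div_le_iff₀ hq']
          linarith
  have hsecond : ∑ n ∈ Ioc 0 N, w n ^ 2 ≤ N * S ^ 2 + N * S := by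
    have e (n : ℕ) : w n ^ 2 = ∑ q ∈ Q, ∑ r ∈ Q, if q ∣ n ∧ r ∣ n then (1 : ℝ) else 0 := by
      rw [sq, hw, sum_mul_sum]
      refine sum_congr rfl fun q _ => sum_congr rfl fun r _ => ?_
      by_cases h1 : q ∣ n <;> by_cases h2 : r ∣ n <;> simp [h1, h2]
    have hpair (q : ℕ) (hq : q ∈ Q) (r : ℕ) (hr : r ∈ Q) :
        ∑ n ∈ Ioc 0 N, (if q ∣ n ∧ r ∣ n then (1 : ℝ) else 0) ≤
          N * (1 / q * (1 / r)) + if q = r then N * (1 / (q : ℝ)) else 0 := by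
      by_cases h : q = r
      · subst h
        simp only [and_self, hcount, if_true]
        have := @Nat.cast_div_le ℝ _ _ _ N q
        have : (N : ℝ) * (1 / q) = N / q := by ring
        have : 0 ≤ (N : ℝ) * (1 / q * (1 / q)) := by positivity
        linarith
      · have hc := (Nat.coprime_primes (hQ q hq) (hQ r hr)).2 h
        have hi (n : ℕ) : (q ∣ n ∧ r ∣ n) ↔ q * r ∣ n :=
          ⟨fun hn => hc.mul_dvd_of_dvd_of_dvd hn.1 hn.2,
            fun hn => ⟨(dvd_mul_right q r).trans hn, (dvd_mul_left r q).trans hn⟩⟩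
        simp only [hi, hcount, h, if_false, add_zero]
        refine Nat.cast_div_le.trans (le_of_eq ?_)
        push_cast
        field_simp
    simp_rw [e]
    rw [sum_comm]
    calc ∑ q ∈ Q, ∑ n ∈ Ioc 0 N, ∑ r ∈ Q, (if q ∣ n ∧ r ∣ n then (1 : ℝ) else 0)
        ≤ ∑ q ∈ Q, ∑ r ∈ Q,
            (N * (1 / (q : ℝ) * (1 / r)) + if q = r then N * (1 / (q : ℝ)) else 0) := by
          refine sum_le_sum fun q hq => ?_
          rw [sum_comm]
          exact sum_le_sum fun r hr => hpair q hq r hr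
      _ = N * S ^ 2 + N * S := by
          simp only [sum_add_distrib, ← mul_sum, Finset.sum_ite_eq, ← sum_mul]
          rw [sum_congr rfl fun q hq => if_pos hq, ← mul_sum, sq]
  have hvar : ∑ n ∈ Ioc 0 N, (w n - S) ^ 2 ≤ 3 * N * S := by
    have : ∑ n ∈ Ioc 0 N, (w n - S) ^ 2 =
        ∑ n ∈ Ioc 0 N, w n ^ 2 - 2 * S * ∑ n ∈ Ioc 0 N, w n + N * S ^ 2 := by
      simp_rw [sub_sq, sum_add_distrib, sum_sub_distrib, mul_sum]
      simp [mul_comm, mul_left_comm, mul_assoc]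
    nlinarith
  have hlow : (#{n ∈ Ioc 0 N | ∀ q ∈ Q, ¬ q ∣ n} : ℝ) * S ^ 2 ≤
      ∑ n ∈ Ioc 0 N, (w n - S) ^ 2 := by
    rw [← nsmul_eq_mul, ← sum_const]
    refine le_trans (le_of_eq (sum_congr rfl fun n hn => ?_))
      (sum_le_sum_of_subset_of_nonneg (filter_subset _ _) fun n _ _ => sq_nonneg _)
    have : w n = 0 := sum_eq_zero fun q hq => if_neg ((Finset.mem_filter.1 hn).2 q hq)
    rw [this]; ring
  rcases hS0.eq_or_lt with h | h
  · rw [← h, mul_zero]; positivity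
  · refine le_of_mul_le_mul_right ?_ h
    linarith [hlow.trans hvar, sq S]

theorem not_dvd_of_mem_primesOneMod {p n : ℕ} (h : ¬ p ∣ n.totient) {N q : ℕ}
    (hq : q ∈ primesOneMod p N) : ¬ q ∣ n := by
  simp only [primesOneMod, Finset.mem_filter] at hq
  intro hqn
  refine h (dvd_trans ?_ (Nat.totient_dvd_of_dvd hqn))
  rw [Nat.totient_prime hq.2.1, ← ZMod.natCast_eq_zero_iff, Nat.cast_sub hq.2.1.one_le]
  simp [hq.2.2]

theorem exists_card_not_dvd_totient_le (p : ℕ) [NeZero p] :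
    ∃ B : ℝ, 0 < B ∧ ∀ᶠ x : ℝ in Filter.atTop,
      (#{n ∈ Ioc 0 ⌊x⌋₊ | ¬ p ∣ n.totient} : ℝ) ≤ B * (x / Real.log (Real.log x)) := by
  obtain ⟨δ, hδ, h⟩ := exists_log_log_le_sum_primesOneMod p
  refine ⟨3 / δ, by positivity, ?_⟩
  have hll : Filter.Tendsto (fun x : ℝ => Real.log (Real.log x)) Filter.atTop Filter.atTop :=
    Real.tendsto_log_atTop.comp Real.tendsto_log_atTop
  filter_upwards [h, Filter.eventually_ge_atTop 0, hll.eventually_gt_atTop 0] with x hx hx0 hl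
  have h1 := card_forall_not_dvd_mul_sum_le (N := ⌊x⌋₊) (Q := primesOneMod p ⌊x⌋₊)
    (fun q hq => (Finset.mem_filter.1 hq).2.1) (filter_subset _ _)
  have h2 : #{n ∈ Ioc 0 ⌊x⌋₊ | ¬ p ∣ n.totient} ≤
      #{n ∈ Ioc 0 ⌊x⌋₊ | ∀ q ∈ primesOneMod p ⌊x⌋₊, ¬ q ∣ n} :=
    card_le_card (monotone_filter_right _ fun n _ hn q hq => not_dvd_of_mem_primesOneMod hn hq)
  have h3 : (#{n ∈ Ioc 0 ⌊x⌋₊ | ¬ p ∣ n.totient} : ℝ) * (δ * Real.log (Real.log x)) ≤ 3 * x :=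
    calc _ ≤ (#{n ∈ Ioc 0 ⌊x⌋₊ | ∀ q ∈ primesOneMod p ⌊x⌋₊, ¬ q ∣ n} : ℝ) *
          ∑ q ∈ primesOneMod p ⌊x⌋₊, 1 / (q : ℝ) := by gcongr
      _ ≤ 3 * ⌊x⌋₊ := h1
      _ ≤ 3 * x := by gcongr; exact Nat.floor_le hx0
  rw [div_mul_div_comm, le_div_iff₀ (by positivity)]
  exact h3

theorem exists_prod_primes_one_sub_inv_lt {c : ℝ} (hc : 0 < c) :
    ∃ Y : Finset ℕ, (∀ p ∈ Y, p.Prime) ∧ ∏ p ∈ Y, (1 - (p : ℝ)⁻¹) < c := by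
  have hns := Nat.Primes.not_summable_one_div
  obtain ⟨s, hs⟩ : ∃ s : Finset Nat.Primes, -Real.log c < ∑ p ∈ s, (1 / (p : ℕ) : ℝ) := by
    by_contra! hcon
    exact hns (summable_of_sum_le (fun p => by positivity) hcon)
  refine ⟨s.map ⟨fun p : Nat.Primes => (p : ℕ), fun _ _ h => Subtype.ext h⟩, fun p hp => ?_, ?_⟩
  · obtain ⟨q, -, rfl⟩ := Finset.mem_map.1 hp
    exact q.2
  · rw [Finset.prod_map]
    calc ∏ p ∈ s, (1 - ((p : ℕ) : ℝ)⁻¹) ≤ ∏ p ∈ s, Real.exp (-(1 / (p : ℕ))) := by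
          refine prod_le_prod (fun p _ => ?_) fun p _ => ?_
          · exact sub_nonneg.2 (Nat.cast_inv_le_one _)
          · have := Real.add_one_le_exp (-(1 / ((p : ℕ) : ℝ)))
            rw [one_div] at *
            linarith
      _ = Real.exp (-∑ p ∈ s, (1 / (p : ℕ) : ℝ)) := by
          rw [← Real.exp_sum, sum_neg_distrib]
      _ < Real.exp (Real.log c) := Real.exp_lt_exp.2 (by linarith)
      _ = c := Real.exp_log hc

theorem totient_le_mul_prod_of_forall_dvd {m : ℕ} (hm : m ≠ 0) {Y : Finset ℕ}
    (hY : ∀ p ∈ Y, p.Prime) (h : ∀ p ∈ Y, p ∣ m) :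
    (m.totient : ℝ) ≤ m * ∏ p ∈ Y, (1 - (p : ℝ)⁻¹) := by
  have e : (m.totient : ℝ) = m * ∏ p ∈ m.primeFactors, (1 - (p : ℝ)⁻¹) := by
    have := congrArg (Rat.cast : ℚ → ℝ) (Nat.totient_eq_mul_prod_factors m)
    push_cast at this
    exact this
  rw [e]
  refine mul_le_mul_of_nonneg_left ?_ m.cast_nonneg
  exact prod_le_prod_of_subset_of_le_one
    (fun p hp => Nat.mem_primeFactors.2 ⟨hY p hp, h p hp, hm⟩)
    (fun p _ => sub_nonneg.2 (Nat.cast_inv_le_one p)) (by simp)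

theorem iterate_totient_le (k m : ℕ) : Nat.totient^[k] m ≤ m := by
  induction k with
  | zero => rfl
  | succ k ih =>
    rw [Function.iterate_succ_apply']
    exact (Nat.totient_le _).trans ih

/-- For `k ≥ 1` only `O(x / log log x)` integers `n ≤ x` satisfy `φ_{k+1}(n) ≥ c n`. -/
theorem exists_card_le_iterate_totient_le {k : ℕ} (hk : k ≠ 0) {c : ℝ} (hc : 0 < c) :
    ∃ B : ℝ, 0 < B ∧ ∀ᶠ x : ℝ in Filter.atTop,
      (#((Finset.Ioc 0 ⌊x⌋₊).filter fun n : ℕ => c * (n : ℝ) ≤ (Nat.totient^[k + 1] n : ℝ)) : ℝ) ≤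
        B * (x / Real.log (Real.log x)) := by
  obtain ⟨Y, hY, hYc⟩ := exists_prod_primes_one_sub_inv_lt hc
  have hB (p : ℕ) : ∃ B : ℝ, 0 < B ∧ (p ∈ Y → ∀ᶠ x : ℝ in Filter.atTop,
      (#{n ∈ Ioc 0 ⌊x⌋₊ | ¬ p ∣ n.totient} : ℝ) ≤ B * (x / Real.log (Real.log x))) := by
    by_cases hp : p ∈ Y
    · have : NeZero p := ⟨(hY p hp).ne_zero⟩
      obtain ⟨B, hB0, hB⟩ := exists_card_not_dvd_totient_le p
      exact ⟨B, hB0, fun _ => hB⟩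
    · exact ⟨1, one_pos, fun h => absurd h hp⟩
  choose B hB0 hB using hB
  have hll : Filter.Tendsto (fun x : ℝ => Real.log (Real.log x)) Filter.atTop Filter.atTop :=
    Real.tendsto_log_atTop.comp Real.tendsto_log_atTop
  have hev : ∀ᶠ x : ℝ in Filter.atTop, ∀ p ∈ Y,
      (#{n ∈ Ioc 0 ⌊x⌋₊ | ¬ p ∣ n.totient} : ℝ) ≤ B p * (x / Real.log (Real.log x)) :=
    (Filter.eventually_all_finset Y).2 hB
  have hsum0 : 0 ≤ ∑ p ∈ Y, B p := sum_nonneg fun p _ => (hB0 p).le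
  refine ⟨∑ p ∈ Y, B p + 1, by positivity, ?_⟩
  filter_upwards [hev, hll.eventually_gt_atTop 0, Filter.eventually_ge_atTop 0] with x hx hl hx0
  have hsub : ((Finset.Ioc 0 ⌊x⌋₊).filter fun n : ℕ => c * (n : ℝ) ≤ (Nat.totient^[k + 1] n : ℝ)) ⊆
      Y.biUnion fun p => {n ∈ Ioc 0 ⌊x⌋₊ | ¬ p ∣ n.totient} := by
    intro n hn
    obtain ⟨hnI, hn⟩ := Finset.mem_filter.1 hn
    simp only [Finset.mem_biUnion, Finset.mem_filter]
    by_contra! hcon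
    have hall (p : ℕ) (hp : p ∈ Y) : p ∣ n.totient := hcon p hp hnI
    have hn0 : 0 < n := (Finset.mem_Ioc.1 hnI).1
    have h1 := totient_le_mul_prod_of_forall_dvd (Nat.totient_pos.2 hn0).ne' hY hall
    have h2 : Nat.totient^[k + 1] n ≤ n.totient.totient := by
      obtain ⟨l, rfl⟩ := Nat.exists_eq_succ_of_ne_zero hk
      simp only [Nat.succ_eq_add_one, Function.iterate_succ_apply]
      exact iterate_totient_le l _
    have h2' : (Nat.totient^[k + 1] n : ℝ) ≤ n.totient.totient := by exact_mod_cast h2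
    have h3 : (n.totient : ℝ) ≤ n := by exact_mod_cast Nat.totient_le n
    have h4 : (0 : ℝ) < n.totient := by exact_mod_cast Nat.totient_pos.2 hn0
    nlinarith
  calc (#((Finset.Ioc 0 ⌊x⌋₊).filter fun n : ℕ => c * (n : ℝ) ≤ (Nat.totient^[k + 1] n : ℝ)) : ℝ)
      ≤ ∑ p ∈ Y, (#{n ∈ Ioc 0 ⌊x⌋₊ | ¬ p ∣ n.totient} : ℝ) := by
        exact_mod_cast (card_le_card hsub).trans card_biUnion_le
    _ ≤ ∑ p ∈ Y, B p * (x / Real.log (Real.log x)) := sum_le_sum hx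
    _ ≤ (∑ p ∈ Y, B p + 1) * (x / Real.log (Real.log x)) := by
        rw [← sum_mul]
        have : 0 ≤ x / Real.log (Real.log x) := by positivity
        linarith

theorem hasSum_moebius_div_sq :
    HasSum (fun n : ℕ => (ArithmeticFunction.moebius n : ℝ) / (n : ℝ) ^ 2) (6 / π ^ 2) := by
  have h2 : 1 < (2 : ℂ).re := by norm_num
  have h := (ArithmeticFunction.LSeriesSummable_moebius_iff.2 h2).LSeriesHasSum
  have hz := ArithmeticFunction.LSeries_zeta_mul_Lseries_moebius h2
  rw [ArithmeticFunction.LSeries_zeta_eq_riemannZeta h2, riemannZeta_two] at hz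
  have hpi : (π : ℂ) ≠ 0 := by simp [Real.pi_ne_zero]
  have hval : LSeries (fun n => (ArithmeticFunction.moebius n : ℂ)) 2 =
      ((6 / π ^ 2 : ℝ) : ℂ) := by
    rw [eq_div_of_mul_eq (by simp [hpi]) ((mul_comm _ _).trans hz)]
    push_cast
    field_simp
  rw [hval, LSeriesHasSum] at h
  rw [← Complex.hasSum_ofReal]
  refine h.congr_fun fun n => ?_
  rcases eq_or_ne n 0 with rfl | hn
  · simp
  · simp [LSeries.term_of_ne_zero hn]

theorem totient_div_self_eq_sum_moebius_div {n : ℕ} (hn : 0 < n) :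
    (n.totient : ℝ) / n =
      ∑ d ∈ n.divisors, (ArithmeticFunction.moebius d : ℝ) / d := by
  have h := (ArithmeticFunction.sum_eq_iff_sum_mul_moebius_eq (R := ℝ)
    (f := fun n => (n.totient : ℝ)) (g := fun n => (n : ℝ))).1
    (fun m _ => by exact_mod_cast Nat.sum_totient m) n hn
  rw [← h, sum_div, ← Nat.sum_divisorsAntidiagonal
    fun d _ => (ArithmeticFunction.moebius d : ℝ) / d]
  refine sum_congr rfl fun x hx => ?_
  obtain ⟨hx, -⟩ := Nat.mem_divisorsAntidiagonal.1 hx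
  have h1 : (x.1 : ℝ) ≠ 0 := by
    rintro h0
    simp only [Nat.cast_eq_zero] at h0
    simp [h0] at hx; omega
  have h2 : (x.2 : ℝ) ≠ 0 := by
    rintro h0
    simp only [Nat.cast_eq_zero] at h0
    simp [h0] at hx; omega
  rw [← hx]
  push_cast
  field_simp

theorem sum_totient_div_le {N : ℕ} (hN : 0 < N) :
    ∑ n ∈ Ioc 0 N, (n.totient : ℝ) / n ≤ 6 / π ^ 2 * N + 2 + Real.log N := by
  have hmu (d : ℕ) : |(ArithmeticFunction.moebius d : ℝ)| ≤ 1 := by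
    exact_mod_cast ArithmeticFunction.abs_moebius_le_one
  have hN' : (0 : ℝ) < N := by exact_mod_cast hN
  let f : ArithmeticFunction ℝ := ⟨fun d => (ArithmeticFunction.moebius d : ℝ) / d, by simp⟩
  have h1 : ∑ n ∈ Ioc 0 N, (n.totient : ℝ) / n =
      ∑ d ∈ Ioc 0 N, (ArithmeticFunction.moebius d : ℝ) / d * (N / d : ℕ) := by
    refine Eq.trans ?_ (ArithmeticFunction.sum_Ioc_mul_zeta_eq_sum f N)
    refine sum_congr rfl fun n hn => ?_
    rw [totient_div_self_eq_sum_moebius_div (Finset.mem_Ioc.1 hn).1,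
      ArithmeticFunction.coe_mul_zeta_apply]
    rfl
  have h2 (d : ℕ) (hd : d ∈ Ioc 0 N) :
      (ArithmeticFunction.moebius d : ℝ) / d * (N / d : ℕ) ≤
        N * ((ArithmeticFunction.moebius d : ℝ) / (d : ℝ) ^ 2) + (d : ℝ)⁻¹ := by
    have hd0 : 0 < d := (Finset.mem_Ioc.1 hd).1
    have hd' : (0 : ℝ) < d := by exact_mod_cast hd0
    have ha : ((N / d : ℕ) : ℝ) ≤ N / d := Nat.cast_div_le
    have hb : (N : ℝ) / d ≤ (N / d : ℕ) + 1 := by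
      rw [div_le_iff₀ hd']
      have : (N : ℝ) ≤ d * (N / d : ℕ) + d := by
        exact_mod_cast (Nat.lt_mul_div_succ N hd0).le
      linarith
    obtain ⟨hl, hu⟩ := abs_le.1 (hmu d)
    have e : (N : ℝ) * ((ArithmeticFunction.moebius d : ℝ) / (d : ℝ) ^ 2) =
        (ArithmeticFunction.moebius d : ℝ) / d * (N / d) := by field_simp
    rw [e, ← sub_le_iff_le_add', ← mul_sub, inv_eq_one_div, div_mul_eq_mul_div]
    refine div_le_div_of_nonneg_right ?_ hd'.le
    nlinarith
  have h3 : ∑ d ∈ Ioc 0 N, (d : ℝ)⁻¹ ≤ 1 + Real.log N := by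
    have := harmonic_le_one_add_log N
    rw [harmonic_eq_sum_Icc] at this
    push_cast at this
    exact this
  have h4 : ∑ d ∈ Ioc 0 N, (ArithmeticFunction.moebius d : ℝ) / (d : ℝ) ^ 2 ≤
      6 / π ^ 2 + (N : ℝ)⁻¹ := by
    have ht := (hasSum_moebius_div_sq.tendsto_sum_nat).add_const (N : ℝ)⁻¹
    refine ge_of_tendsto ht ?_
    filter_upwards [Filter.eventually_gt_atTop N] with M hM
    obtain ⟨K, rfl⟩ : ∃ K, M = K + 1 := ⟨M - 1, by omega⟩
    have hNK : N ≤ K := by omega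
    have e : ∑ d ∈ range (K + 1), (ArithmeticFunction.moebius d : ℝ) / (d : ℝ) ^ 2 =
        ∑ d ∈ Ioc 0 N, (ArithmeticFunction.moebius d : ℝ) / (d : ℝ) ^ 2 +
        ∑ d ∈ Ioc N K, (ArithmeticFunction.moebius d : ℝ) / (d : ℝ) ^ 2 := by
      rw [sum_Ioc_consecutive _ (Nat.zero_le N) hNK]
      symm
      refine sum_subset (fun n hn => ?_) fun n hn hn' => ?_
      · simp only [Finset.mem_Ioc, Finset.mem_range] at *; omega
      · have : n = 0 := by simp only [Finset.mem_Ioc, Finset.mem_range] at *; omega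
        simp [this]
    have h5 : -∑ d ∈ Ioc N K, (ArithmeticFunction.moebius d : ℝ) / (d : ℝ) ^ 2 ≤
        (N : ℝ)⁻¹ := by
      have h6 := sum_Ioc_inv_sq_le_sub (α := ℝ) hN.ne' hNK
      have h7 : 0 ≤ (K : ℝ)⁻¹ := by positivity
      rw [← sum_neg_distrib]
      refine (sum_le_sum fun d _ => ?_).trans (h6.trans (sub_le_self _ h7))
      rw [← neg_div, inv_eq_one_div]
      refine div_le_div_of_nonneg_right ?_ (sq_nonneg _)
      exact neg_le.1 (abs_le.1 (hmu d)).1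
    linarith
  calc ∑ n ∈ Ioc 0 N, (n.totient : ℝ) / n
      ≤ ∑ d ∈ Ioc 0 N,
        (N * ((ArithmeticFunction.moebius d : ℝ) / (d : ℝ) ^ 2) + (d : ℝ)⁻¹) := by
        rw [h1]; exact sum_le_sum h2
    _ ≤ N * (6 / π ^ 2 + (N : ℝ)⁻¹) + (1 + Real.log N) := by
        rw [sum_add_distrib, ← mul_sum]
        gcongr
    _ = 6 / π ^ 2 * N + 2 + Real.log N := by field_simp; ring

theorem card_le_totient_le {c : ℝ} (hc : 0 < c) {x : ℝ} (hx : 1 ≤ x) :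
    (#((Finset.Ioc 0 ⌊x⌋₊).filter fun n : ℕ => c * (n : ℝ) ≤ (n.totient : ℝ)) : ℝ) ≤
      (6 / π ^ 2 * x + 2 + Real.log x) / c := by
  have hN : 0 < ⌊x⌋₊ := Nat.floor_pos.2 hx
  have hNx : (⌊x⌋₊ : ℝ) ≤ x := Nat.floor_le (by linarith)
  rw [le_div_iff₀ hc, ← nsmul_eq_mul, ← sum_const]
  calc ∑ _n ∈ (Finset.Ioc 0 ⌊x⌋₊).filter fun n : ℕ => c * (n : ℝ) ≤ (n.totient : ℝ), c
      ≤ ∑ n ∈ (Finset.Ioc 0 ⌊x⌋₊).filter fun n : ℕ => c * (n : ℝ) ≤ (n.totient : ℝ),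
          (n.totient : ℝ) / n := by
        refine sum_le_sum fun n hn => ?_
        obtain ⟨hn1, hn2⟩ := Finset.mem_filter.1 hn
        have : (0 : ℝ) < n := by exact_mod_cast (Finset.mem_Ioc.1 hn1).1
        rwa [le_div_iff₀ this]
    _ ≤ ∑ n ∈ Finset.Ioc 0 ⌊x⌋₊, (n.totient : ℝ) / n :=
        sum_le_sum_of_subset_of_nonneg (filter_subset _ _) fun n _ _ => by positivity
    _ ≤ 6 / π ^ 2 * ⌊x⌋₊ + 2 + Real.log ⌊x⌋₊ := sum_totient_div_le hN
    _ ≤ 6 / π ^ 2 * x + 2 + Real.log x := by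
        gcongr

theorem eventually_two_add_log_mul_le :
    ∀ᶠ x : ℝ in Filter.atTop,
      (2 + Real.log x) * (Real.log (Real.log (Real.log x)) * Real.log (Real.log x) * Real.log x) ≤
        x := by
  have hlll : Filter.Tendsto (fun x : ℝ => Real.log (Real.log (Real.log x)))
      Filter.atTop Filter.atTop :=
    Real.tendsto_log_atTop.comp (Real.tendsto_log_atTop.comp Real.tendsto_log_atTop)
  filter_upwards [(isLittleO_pow_log_id_atTop (n := 4)).bound (by norm_num : (0 : ℝ) < 1 / 3),
    Filter.eventually_ge_atTop 0, Real.tendsto_log_atTop.eventually_ge_atTop 1,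
    hlll.eventually_ge_atTop 0] with x hx hx0 h1 h3
  have h2 := Real.log_le_self (by linarith : 0 ≤ Real.log x)
  have h20 := Real.log_nonneg h1
  have h3' := Real.log_le_self h20
  rw [Real.norm_of_nonneg (by positivity), id_eq, Real.norm_of_nonneg hx0] at hx
  calc _ ≤ (3 * Real.log x) * (Real.log x * Real.log x * Real.log x) := by
        refine mul_le_mul (by linarith) ?_ (by positivity) (by positivity)
        exact mul_le_mul_of_nonneg_right
          (mul_le_mul (h3'.trans h2) h2 h20 (by linarith)) (by linarith)
    _ = 3 * Real.log x ^ 4 := by ring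
    _ ≤ x := by linarith

theorem eventually_mul_div_log_log_le (k : ℕ) {B K : ℝ} (hB : 0 < B) (hK : 0 < K) :
    ∀ᶠ x : ℝ in Filter.atTop,
      B * (x / Real.log (Real.log x)) ≤ K * (x / Real.log (Real.log (Real.log x)) ^ k) := by
  have hll : Filter.Tendsto (fun x : ℝ => Real.log (Real.log x)) Filter.atTop Filter.atTop :=
    Real.tendsto_log_atTop.comp Real.tendsto_log_atTop
  have hlll := Real.tendsto_log_atTop.comp hll
  filter_upwards [hll.eventually ((isLittleO_pow_log_id_atTop (n := k)).bound (div_pos hK hB)),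
    Filter.eventually_ge_atTop 0, hll.eventually_gt_atTop 0, hlll.eventually_gt_atTop 0]
    with x hx hx0 h2 h3
  simp only [Function.comp_apply] at h3
  rw [Real.norm_of_nonneg (by positivity), id_eq, Real.norm_of_nonneg h2.le,
    div_mul_eq_mul_div, le_div_iff₀ hB] at hx
  rw [← mul_div_assoc, ← mul_div_assoc, div_le_div_iff₀ h2 (by positivity)]
  nlinarith [mul_le_mul_of_nonneg_left hx hx0]

/-- Fix an integer `k ≥ 0` and real `c > 0`. There exists `C > 0` such that for all
sufficiently large real `x`, the number of positive `n ≤ x` with `φ_{k+1}(n) ≥ c·n` is at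
most `(6/(k!·e^{kγ}·π²)) · x/(c·(log log log x)^k)
  + C · x/(c·(log log log x)^{k+1}·(log log x)·(log x))`. -/
theorem iterated_totient_count_initial_bound (k : ℕ) (c : ℝ) (hc : 0 < c) :
    ∃ C : ℝ, 0 < C ∧ ∃ x₀ : ℝ, ∀ x : ℝ, x₀ ≤ x →
      (((Finset.Icc 1 ⌊x⌋₊).filter
          (fun n : ℕ => c * (n : ℝ) ≤ (Nat.totient^[k + 1] n : ℝ))).card : ℝ) ≤
        6 / ((Nat.factorial k : ℝ) *
              Real.exp ((k : ℝ) * Real.eulerMascheroniConstant) * π ^ 2) *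
            (x / (c * Real.log (Real.log (Real.log x)) ^ k)) +
          C * (x / (c * Real.log (Real.log (Real.log x)) ^ (k + 1) *
            Real.log (Real.log x) * Real.log x)) := by
  have hI (N : ℕ) : Finset.Icc 1 N = Finset.Ioc 0 N := rfl
  simp_rw [hI]
  have hlll : Filter.Tendsto (fun x : ℝ => Real.log (Real.log (Real.log x)))
      Filter.atTop Filter.atTop :=
    Real.tendsto_log_atTop.comp (Real.tendsto_log_atTop.comp Real.tendsto_log_atTop)
  have hll : Filter.Tendsto (fun x : ℝ => Real.log (Real.log x)) Filter.atTop Filter.atTop :=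
    Real.tendsto_log_atTop.comp Real.tendsto_log_atTop
  refine ⟨1, one_pos, Filter.eventually_atTop.1 ?_⟩
  rcases Nat.eq_zero_or_pos k with rfl | hk
  · filter_upwards [eventually_two_add_log_mul_le, Filter.eventually_ge_atTop 1,
      Real.tendsto_log_atTop.eventually_gt_atTop 0, hll.eventually_gt_atTop 0,
      hlll.eventually_gt_atTop 0] with x hx hx1 h1 h2 h3
    refine (card_le_totient_le hc hx1).trans ?_
    have h4 : (2 + Real.log x) / c ≤
        x / (c * Real.log (Real.log (Real.log x)) ^ (0 + 1) * Real.log (Real.log x) *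
          Real.log x) := by
      rw [div_le_div_iff₀ hc (by positivity), zero_add, pow_one]
      linarith [mul_le_mul_of_nonneg_left hx hc.le]
    calc (6 / π ^ 2 * x + 2 + Real.log x) / c = 6 / π ^ 2 * (x / c) + (2 + Real.log x) / c := by
          ring
      _ ≤ _ := by
          simp only [Nat.factorial_zero, Nat.cast_one, Nat.cast_zero, zero_mul, Real.exp_zero,
            one_mul, pow_zero, mul_one]
          linarith
  · obtain ⟨B, hB0, hB⟩ := exists_card_le_iterate_totient_le hk.ne' hc
    have hK : 0 < 6 / ((Nat.factorial k : ℝ) *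
        Real.exp ((k : ℝ) * Real.eulerMascheroniConstant) * π ^ 2) / c := by positivity
    filter_upwards [hB, eventually_mul_div_log_log_le k hB0 hK, Filter.eventually_ge_atTop 0,
      Real.tendsto_log_atTop.eventually_gt_atTop 0, hll.eventually_gt_atTop 0,
      hlll.eventually_gt_atTop 0] with x hx hxK hx0 h1 h2 h3
    refine (hx.trans hxK).trans ?_
    rw [div_mul_div_comm, ← mul_div_assoc]
    exact le_add_of_nonneg_right (by positivity)
end

section
/- There exists y₀ ≥ 2 such that for every real y ≥ y₀, every integer k ≥ 1, and every positive integer n: if P(y) divides φ_k(n), then φ_{k+1}(n) < φ_k(n)/log y. -/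
open Real Finset

/-- The partial Euler product at `1` dominates the harmonic sum. -/
theorem log_add_one_le_prod_primesLE (N : ℕ) :
    Real.log (N + 1 : ℕ) ≤ ∏ p ∈ N.primesLE, (1 - (p : ℝ)⁻¹)⁻¹ := by
  let f : ℕ →* ℝ :=
    (invMonoidWithZeroHom : ℝ →*₀ ℝ).toMonoidHom.comp (Nat.castRingHom ℝ : ℕ →* ℝ)
  have hf (m : ℕ) : f m = (m : ℝ)⁻¹ := rfl
  have hnorm {p : ℕ} (hp : p.Prime) : ‖f p‖ < 1 := by
    rw [hf, norm_inv, Real.norm_natCast]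
    exact inv_lt_one_of_one_lt₀ (by exact_mod_cast hp.one_lt)
  have hsum := (EulerProduct.summable_and_hasSum_smoothNumbers_prod_primesBelow_geometric
    hnorm (N + 1)).2
  have hmem (i : ℕ) (hi : i ∈ range N) : i + 1 ∈ (N + 1).smoothNumbers := by
    refine Nat.mem_smoothNumbers'.2 fun p _ hpi ↦ ?_
    have := Nat.le_of_dvd i.succ_pos hpi
    have := mem_range.1 hi
    omega
  let g : {i // i ∈ range N} → (N + 1).smoothNumbers := fun i ↦ ⟨i + 1, hmem i i.2⟩
  have hg : Function.Injective g := fun i j hij ↦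
    Subtype.ext (Nat.succ_injective (congrArg Subtype.val hij))
  have hle := sum_le_hasSum ((range N).attach.map ⟨g, hg⟩)
    (fun m _ ↦ by rw [hf]; positivity) hsum
  rw [sum_map] at hle
  have hharm : ((harmonic N : ℚ) : ℝ) = ∑ i ∈ (range N).attach, f (g i) := by
    rw [harmonic, Rat.cast_sum, ← sum_attach]
    exact sum_congr rfl fun i _ ↦ by simp [hf, g]
  calc Real.log (N + 1 : ℕ) ≤ harmonic N := log_add_one_le_harmonic N
    _ = ∑ i ∈ (range N).attach, f (g i) := hharm
    _ ≤ _ := hle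

/-- If every prime `p ≤ y` divides the positive integer `m`, then `φ m < m / log y`. -/
theorem totient_lt_div_log_of_primorial_dvd {y : ℝ} (hy : 1 < y) {m : ℕ} (hm : 0 < m)
    (hdvd : primorial ⌊y⌋₊ ∣ m) : (Nat.totient m : ℝ) < m / Real.log y := by
  have hfac {p : ℕ} (hp : p.Prime) : 0 < 1 - (p : ℝ)⁻¹ :=
    sub_pos.2 (inv_lt_one_of_one_lt₀ (by exact_mod_cast hp.one_lt))
  have hsub : (⌊y⌋₊).primesLE ⊆ m.primeFactors := by
    rw [← primeFactors_primorial]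
    exact Nat.primeFactors_mono hdvd hm.ne'
  have hprod : ∏ p ∈ m.primeFactors, (1 - (p : ℝ)⁻¹) ≤
      ∏ p ∈ (⌊y⌋₊).primesLE, (1 - (p : ℝ)⁻¹) :=
    prod_le_prod_of_subset_of_le_one hsub
      (fun p hp ↦ (hfac (Nat.prime_of_mem_primeFactors hp)).le)
      fun p _ _ ↦ sub_le_self _ (by positivity)
  have hlog : Real.log y < (∏ p ∈ (⌊y⌋₊).primesLE, (1 - (p : ℝ)⁻¹))⁻¹ := by
    rw [← prod_inv_distrib]
    refine (Real.log_lt_log (by linarith) ?_).trans_le (log_add_one_le_prod_primesLE _)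
    exact_mod_cast Nat.lt_floor_add_one y
  have htot : (Nat.totient m : ℝ) = m * ∏ p ∈ m.primeFactors, (1 - (p : ℝ)⁻¹) := by
    have h := congrArg (Rat.cast : ℚ → ℝ) (Nat.totient_eq_mul_prod_factors m)
    push_cast at h
    exact h
  rw [htot, div_eq_mul_inv]
  gcongr
  exact hprod.trans_lt ((lt_inv_comm₀ (Real.log_pos hy)
    (prod_pos fun p hp ↦ hfac (Nat.prime_of_mem_primesLE hp))).1 hlog)


open Real Finset

/-- There exists `y₀ ≥ 2` such that for every real `y ≥ y₀`, every integer `k ≥ 1`, and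
every positive integer `n`: if `P(y)` (the primorial of `y`) divides `φ_k(n)`, then
`φ_{k+1}(n) < φ_k(n)/log y`. -/
theorem iterated_totient_lt_of_primorial_dvd :
    ∃ y₀ : ℝ, 2 ≤ y₀ ∧ ∀ y : ℝ, y₀ ≤ y → ∀ k : ℕ, 1 ≤ k → ∀ n : ℕ, 0 < n →
      primorial ⌊y⌋₊ ∣ Nat.totient^[k] n →
      (Nat.totient^[k + 1] n : ℝ) < (Nat.totient^[k] n : ℝ) / Real.log y := by
  refine ⟨2, le_rfl, fun y hy k _ n hn hdvd ↦ ?_⟩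
  have hpos : 0 < Nat.totient^[k] n :=
    Function.Iterate.rec (fun m ↦ 0 < m) hn (fun _ ↦ Nat.totient_pos.2) k
  rw [Function.iterate_succ_apply']
  exact totient_lt_div_log_of_primorial_dvd (by linarith) hpos hdvd
end

section
/- Let c > 0 and δ > 0 be real numbers, let k ≥ 1 be an integer, and let y ≥ 2 be a real number such that δ/log y ≤ c and such that the product of (1 − 1/p) over all primes p ≤ y is strictly less than 1/log y. Then for every real x ≥ 1, the number of positive integers n ≤ x with φ_{k+1}(n) ≥ c·n is at most the number of positive integers n ≤ x with φ_k(n) ≥ δ·n plus the number of positive integers n ≤ x such that P(y) does not divide φ_k(n). -/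
open Real Finset

/-- Dropping prime factors from Euler's product formula gives an upper bound for the totient. -/
theorem totient_le_mul_prod_of_subset_primeFactors {m : ℕ} {s : Finset ℕ}
    (hs : s ⊆ m.primeFactors) :
    (Nat.totient m : ℝ) ≤ m * ∏ p ∈ s, (1 - 1 / (p : ℝ)) := by
  have h : (Nat.totient m : ℝ) = m * ∏ p ∈ m.primeFactors, (1 - 1 / (p : ℝ)) := by
    have h' := congrArg (Rat.cast (K := ℝ)) (Nat.totient_eq_mul_prod_factors m)
    push_cast at h'
    simpa only [one_div] using h'
  rw [h]
  refine mul_le_mul_of_nonneg_left (Finset.prod_le_prod_of_subset_of_le_one hs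
    (fun p hp => ?_) (fun p _ _ => ?_)) m.cast_nonneg
  · have hp1 : (1 : ℝ) ≤ p := by exact_mod_cast (Nat.prime_of_mem_primeFactors hp).one_le
    rw [sub_nonneg]
    exact div_le_one_of_le₀ hp1 (by positivity)
  · rw [sub_le_self_iff]
    positivity

theorem iterate_totient_pos {n : ℕ} (hn : 0 < n) (k : ℕ) : 0 < Nat.totient^[k] n := by
  induction k with
  | zero => exact hn
  | succ k ih =>
    rw [Function.iterate_succ_apply']
    exact Nat.totient_pos.2 ih

/-- Let `c > 0`, `δ > 0`, `k ≥ 1`, and `y ≥ 2` with `δ/log y ≤ c` and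
`∏_{p ≤ y} (1 − 1/p) < 1/log y`. Then for every `x ≥ 1`,
`#{n ≤ x : φ_{k+1}(n) ≥ c·n} ≤ #{n ≤ x : φ_k(n) ≥ δ·n} + #{n ≤ x : P(y) ∤ φ_k(n)}`. -/
theorem count_split (c δ : ℝ) (hc : 0 < c) (hδ : 0 < δ) (k : ℕ) (hk : 1 ≤ k)
    (y : ℝ) (hy : 2 ≤ y) (hδc : δ / Real.log y ≤ c)
    (hprod : (∏ p ∈ (Finset.range (⌊y⌋₊ + 1)).filter Nat.Prime, (1 - 1 / (p : ℝ))) <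
      1 / Real.log y) :
    ∀ x : ℝ, 1 ≤ x →
      ((Finset.Icc 1 ⌊x⌋₊).filter
          (fun n : ℕ => c * (n : ℝ) ≤ (Nat.totient^[k + 1] n : ℝ))).card ≤
        ((Finset.Icc 1 ⌊x⌋₊).filter
            (fun n : ℕ => δ * (n : ℝ) ≤ (Nat.totient^[k] n : ℝ))).card +
          ((Finset.Icc 1 ⌊x⌋₊).filter
            (fun n : ℕ => ¬ primorial ⌊y⌋₊ ∣ Nat.totient^[k] n)).card := by
  intro x _
  refine le_trans (Finset.card_le_card fun n hn => ?_) (Finset.card_union_le _ _)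
  simp only [Finset.mem_union, Finset.mem_filter] at hn ⊢
  obtain ⟨hmem, hn⟩ := hn
  by_contra! hcon
  have hlt := hcon.1 hmem
  have hdvd := hcon.2 hmem
  have hpos : 0 < Nat.totient^[k] n := iterate_totient_pos (Finset.mem_Icc.1 hmem).1 k
  rw [Function.iterate_succ_apply'] at hn
  set m := Nat.totient^[k] n
  have hlog : 0 < Real.log y := Real.log_pos (by linarith)
  have hsub : (Finset.range (⌊y⌋₊ + 1)).filter Nat.Prime ⊆ m.primeFactors := by
    intro p hp
    have hp' := Finset.mem_filter.1 hp
    exact Nat.mem_primeFactors.2 ⟨hp'.2, (Finset.dvd_prod_of_mem _ hp).trans hdvd, hpos.ne'⟩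
  refine absurd hn (not_le.2 ?_)
  calc (Nat.totient m : ℝ)
      ≤ m * ∏ p ∈ (Finset.range (⌊y⌋₊ + 1)).filter Nat.Prime, (1 - 1 / (p : ℝ)) :=
        totient_le_mul_prod_of_subset_primeFactors hsub
    _ < m * (1 / Real.log y) := by gcongr
    _ ≤ δ * n * (1 / Real.log y) := by gcongr
    _ = δ / Real.log y * n := by ring
    _ ≤ c * n := by gcongr
end
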